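/- arXiv:1704.02585 — 4 statements merged into one kernel-verified Lean document; each statement's English description precedes it below -/
import Mathlib

section
/- (Pfaffian Desnanot–Jacobi identity) Let A be a 2m×2m skew-symmetric matrix with rows/columns indexed by (1,…,2m), and let i < j < k < l be row/column indices. Then Pf A^{i,j} · Pf A^{k,l} − Pf A^{i,k} · Pf A^{j,l} + Pf A^{i,l} · Pf A^{j,k} = Pf A · Pf A^{i,j,k,l}, where A^{i_1,…,i_p} denotes the skew-symmetric matrix obtained from A by deleting the rows and columns with indices i_1,…,i_p. -/
open Matrix Finset

variable {R : Type*} [CommRing R]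

/-- The index `2i` among `Fin n` (for `n` even, `i < n/2`). -/
def pfLo {n : ℕ} (_h : n % 2 = 0) (i : Fin (n / 2)) : Fin n :=
  ⟨2 * i.val, by have := i.isLt; omega⟩

/-- The index `2i+1` among `Fin n` (for `n` even, `i < n/2`). -/
def pfHi {n : ℕ} (_h : n % 2 = 0) (i : Fin (n / 2)) : Fin n :=
  ⟨2 * i.val + 1, by have := i.isLt; omega⟩

/-- The Pfaffian of an `n × n` matrix, as the sum
`∑_{π ∈ F_n} sgn(π) · a_{π(1),π(2)} ⋯ a_{π(n−1),π(n)}` over the set `F_n` of permutations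
satisfying `π(1) < π(3) < ⋯ < π(n−1)` and `π(2i−1) < π(2i)`; it is `0` when `n` is odd. -/
def pf {n : ℕ} (A : Matrix (Fin n) (Fin n) R) : R :=
  if h : n % 2 = 0 then
    ∑ π : Equiv.Perm (Fin n),
      if (∀ i : Fin (n / 2), π (pfLo h i) < π (pfHi h i)) ∧
          (∀ i j : Fin (n / 2), i < j → π (pfLo h i) < π (pfLo h j)) then
        ((Equiv.Perm.sign π : ℤ) : R) * ∏ i : Fin (n / 2), A (π (pfLo h i)) (π (pfHi h i))
      else 0
  else 0

/-- The skew-symmetric matrix obtained from `A` by deleting the rows and columns whose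
indices lie in `s`. -/
def delRC {n : ℕ} (A : Matrix (Fin n) (Fin n) R) (s : Finset (Fin n)) :
    Matrix (Fin sᶜ.card) (Fin sᶜ.card) R :=
  A.submatrix (fun i => (sᶜ.orderIsoOfFin rfl i : Fin n))
    (fun i => (sᶜ.orderIsoOfFin rfl i : Fin n))


namespace PfDJ
open CliffordAlgebra

abbrev Ext (R : Type*) [CommRing R] (N : ℕ) := CliffordAlgebra (0 : QuadraticForm R (Fin N → R))

noncomputable def e (R : Type*) [CommRing R] {N : ℕ} (a : Fin N) : Ext R N :=
  ι (0 : QuadraticForm R (Fin N → R)) (Pi.single a 1)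

noncomputable def bil {N : ℕ} (A : Matrix (Fin N) (Fin N) R) :
    LinearMap.BilinForm R (Fin N → R) :=
  let U : LinearMap.BilinForm R (Fin N → R) :=
    Matrix.toLinearMap₂' R (Matrix.of fun a b => if a < b then A a b else 0)
  U - U.flip

lemma bil_single {N : ℕ} (A : Matrix (Fin N) (Fin N) R) (a b : Fin N) :
    bil A (Pi.single a 1) (Pi.single b 1) =
      (if a < b then A a b else 0) - (if b < a then A b a else 0) := by
  simp only [bil, LinearMap.sub_apply, LinearMap.BilinForm.flip_apply]
  have h : ∀ (M : Matrix (Fin N) (Fin N) R) (a b : Fin N),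
      (Matrix.toLinearMap₂' R M : LinearMap.BilinForm R (Fin N → R)) (Pi.single a 1)
        (Pi.single b 1) = M a b := by
    intro M a b
    simp [Matrix.toLinearMap₂'_apply']
  rw [h, h]
  rfl

lemma bil_self {N : ℕ} (A : Matrix (Fin N) (Fin N) R) (x : Fin N → R) : bil A x x = 0 := by
  simp only [bil, LinearMap.sub_apply, LinearMap.BilinForm.flip_apply, sub_self]

lemma bil_proof {N : ℕ} (A : Matrix (Fin N) (Fin N) R) :
    LinearMap.BilinMap.toQuadraticMap (-(bil A)) = (0 : QuadraticForm R (Fin N → R)) - 0 := by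
  ext x
  simp [bil_self]

/-- The Pfaffian functional on the exterior algebra. -/
noncomputable def P {N : ℕ} (A : Matrix (Fin N) (Fin N) R) : Ext R N →ₗ[R] R :=
  (ExteriorAlgebra.algebraMapInv (R := R) (M := Fin N → R)).toLinearMap ∘ₗ
    (changeForm (bil_proof A))

lemma P_one {N : ℕ} (A : Matrix (Fin N) (Fin N) R) : P A 1 = 1 := by
  simp only [P, LinearMap.comp_apply, changeForm_one]
  exact map_one (ExteriorAlgebra.algebraMapInv (R := R) (M := Fin N → R))

lemma P_mul {N : ℕ} (A : Matrix (Fin N) (Fin N) R) (m : Fin N → R) (x : Ext R N) :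
    P A (ι _ m * x) = P A (contractLeft (bil A m) x) := by
  simp only [P, LinearMap.comp_apply, changeForm_ι_mul, changeForm_contractLeft]
  rw [LinearMap.neg_apply, map_neg, LinearMap.neg_apply, sub_neg_eq_add, map_add]
  convert zero_add _
  have : (ExteriorAlgebra.algebraMapInv (R := R) (M := Fin N → R)) (ExteriorAlgebra.ι R m) = 0 := by
    simp [ExteriorAlgebra.algebraMapInv]
  refine (map_mul (ExteriorAlgebra.algebraMapInv (R := R) (M := Fin N → R)) _ _).trans ?_
  erw [this, zero_mul]

lemma dual_eq {N : ℕ} (d : Module.Dual R (Fin N → R)) :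
    d = ∑ a, d (Pi.single a 1) • (LinearMap.proj a : (Fin N → R) →ₗ[R] R) := by
  refine LinearMap.pi_ext' fun a => LinearMap.ext_ring ?_
  simp [Pi.single_apply]

noncomputable def phi {N : ℕ} (A : Matrix (Fin N) (Fin N) R) (v : Ext R N) :
    Module.Dual R (Fin N → R) :=
  P A ∘ₗ (LinearMap.mulRight R v) ∘ₗ ι _

lemma phi_apply {N : ℕ} (A : Matrix (Fin N) (Fin N) R) (v : Ext R N) (m) :
    phi A v m = P A (ι _ m * v) := rfl

lemma contr_eq {N : ℕ} (d : Module.Dual R (Fin N → R)) (x : Ext R N) :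
    contractLeft d x = ∑ a, d (Pi.single a 1) •
      contractLeft (LinearMap.proj a : (Fin N → R) →ₗ[R] R) x := by
  conv_lhs => rw [dual_eq d]
  simp only [map_sum, map_smul, LinearMap.sum_apply, LinearMap.smul_apply]

lemma P_phi {N : ℕ} (A : Matrix (Fin N) (Fin N) R) (u v : Ext R N) :
    P A (contractLeft (phi A v) u) = ∑ a, ∑ b, bil A (Pi.single a 1) (Pi.single b 1) *
      P A (contractLeft (LinearMap.proj a : (Fin N → R) →ₗ[R] R) u) *
      P A (contractLeft (LinearMap.proj b : (Fin N → R) →ₗ[R] R) v) := by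
  rw [contr_eq, map_sum]
  refine Finset.sum_congr rfl fun a _ => ?_
  rw [map_smul, phi_apply, P_mul, contr_eq, map_sum, smul_eq_mul, Finset.sum_mul]
  refine Finset.sum_congr rfl fun b _ => ?_
  rw [map_smul, smul_eq_mul]; ring

lemma P_phi_symm {N : ℕ} (A : Matrix (Fin N) (Fin N) R) (u v : Ext R N) :
    P A (contractLeft (phi A v) u) = - P A (contractLeft (phi A u) v) := by
  rw [P_phi, P_phi, Finset.sum_comm, ← Finset.sum_neg_distrib]
  refine Finset.sum_congr rfl fun a _ => ?_
  rw [← Finset.sum_neg_distrib]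
  refine Finset.sum_congr rfl fun b _ => ?_
  simp only [bil_single]; ring

lemma e_sq {N : ℕ} (a : Fin N) : e R a * e R a = 0 := by
  simp [e]

lemma e_anti {N : ℕ} (a b : Fin N) : e R a * e R b = - (e R b * e R a) := by
  rw [eq_neg_iff_add_eq_zero]
  simp only [e, ι_mul_ι_add_swap]
  simp [QuadraticMap.polar]

lemma e_anti' {N : ℕ} (a b : Fin N) (x : Ext R N) :
    e R a * (e R b * x) = - (e R b * (e R a * x)) := by
  rw [← mul_assoc, e_anti, neg_mul, mul_assoc]

variable (R) in
noncomputable def EL {N : ℕ} (L : List (Fin N)) : Ext R N := (L.map (e R)).prod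

@[simp] lemma EL_nil {N : ℕ} : EL R ([] : List (Fin N)) = 1 := rfl
@[simp] lemma EL_cons {N : ℕ} (a) (L : List (Fin N)) : EL R (a :: L) = e R a * EL R L := by
  simp [EL]

lemma mem_mul {N : ℕ} (L : List (Fin N)) (a) (h : a ∈ L) : e R a * EL R L = 0 := by
  induction L with
  | nil => simp at h
  | cons b L ih =>
    rw [EL_cons]
    rcases List.mem_cons.1 h with rfl | h
    · rw [← mul_assoc, e_sq, zero_mul]
    · rw [e_anti', ih h, mul_zero, neg_zero]

lemma contr_e {N : ℕ} (d : Module.Dual R (Fin N → R)) (a) (x : Ext R N) :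
    contractLeft d (e R a * x) = d (Pi.single a 1) • x - e R a * contractLeft d x :=
  contractLeft_ι_mul ..

lemma contr_zero {N : ℕ} (d : Module.Dual R (Fin N → R)) (L : List (Fin N))
    (h : ∀ a ∈ L, d (Pi.single a 1) = 0) : contractLeft d (EL R L) = 0 := by
  induction L with
  | nil => simp
  | cons b L ih =>
    rw [EL_cons, contr_e, h b (by simp), ih (fun a ha => h a (by simp [ha]))]
    simp

lemma plucker {N : ℕ} (A : Matrix (Fin N) (Fin N) R) (L : List (Fin N)) (i j k l : Fin N) :
    P A (EL R (i :: j :: L)) * P A (EL R (k :: l :: L))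
    - P A (EL R (i :: k :: L)) * P A (EL R (j :: l :: L))
    + P A (EL R (i :: l :: L)) * P A (EL R (j :: k :: L))
     = P A (EL R (i :: j :: k :: l :: L)) * P A (EL R L) := by
  have key := P_phi_symm A (EL R (j :: k :: l :: L)) (EL R (i :: L))
  have ph : ∀ v a, phi A v (Pi.single a 1) = P A (e R a * v) := fun v a => rfl
  have h1 : contractLeft (phi A (EL R (i :: L))) (EL R L) = 0 := by
    refine contr_zero _ _ fun a ha => ?_
    rw [ph, EL_cons, e_anti', mem_mul _ _ ha, mul_zero, neg_zero, map_zero]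
  have h2 : contractLeft (phi A (EL R (j :: k :: l :: L))) (EL R L) = 0 := by
    refine contr_zero _ _ fun a ha => ?_
    rw [ph, mem_mul _ _ (by simp [ha]), map_zero]
  simp only [EL_cons] at key h1 h2 ⊢
  simp only [contr_e, h1, h2, ph, mul_zero, sub_zero, map_sub, map_smul, smul_eq_mul,
    mul_sub, mul_smul_comm] at key
  rw [e_anti' j i, e_anti' k i, e_anti' l i] at key
  simp only [map_neg] at key
  linear_combination -key

lemma EL_insert {N : ℕ} (a : Fin N) (L : List (Fin N)) (hL : L.Pairwise (· ≤ ·)) :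
    e R a * EL R L = (-1) ^ (L.countP (· < a)) * EL R (L.orderedInsert (· ≤ ·) a) := by
  induction L with
  | nil => simp
  | cons b L ih =>
    rw [List.orderedInsert]
    rw [List.pairwise_cons] at hL
    split_ifs with h
    · have : (b :: L).countP (· < a) = 0 := by
        rw [List.countP_eq_zero]
        intro x hx
        rcases List.mem_cons.1 hx with rfl | hx
        · simpa using h
        · simpa using h.trans (hL.1 _ hx)
      rw [this]; simp
    · have hba : b < a := not_le.1 h
      rw [EL_cons, EL_cons, e_anti', ih hL.2, List.countP_cons_of_pos (by simpa using hba), pow_succ]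
      rcases neg_one_pow_eq_or (Ext R N) (L.countP (· < a)) with h | h <;> rw [h] <;> simp

variable (R) in
noncomputable def ES {N : ℕ} (s : Finset (Fin N)) : Ext R N := EL R (s.sort (· ≤ ·))

lemma sort_insert' {N : ℕ} (a : Fin N) (s : Finset (Fin N)) (ha : a ∉ s) :
    (insert a s).sort (· ≤ ·) = (s.sort (· ≤ ·)).orderedInsert (· ≤ ·) a := by
  refine List.Perm.eq_of_pairwise (le := (· ≤ ·)) (fun _ _ _ _ => le_antisymm) (Finset.pairwise_sort _ _)
    ((Finset.pairwise_sort s (· ≤ ·)).orderedInsert _ _) ?_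
  refine List.Perm.trans ?_ (List.perm_orderedInsert _ _ _).symm
  rw [← Multiset.coe_eq_coe, Finset.sort_eq, ← Multiset.cons_coe, Finset.sort_eq,
    Finset.insert_val_of_notMem ha]

noncomputable def sg {N : ℕ} (a : Fin N) (s : Finset (Fin N)) : ℤ :=
  (-1) ^ ((s.sort (· ≤ ·)).countP (· < a))

lemma sg_insert {N : ℕ} (a b : Fin N) (s : Finset (Fin N)) (hb : b ∉ s) (hab : a < b) :
    sg a (insert b s) = sg a s := by
  unfold sg
  rw [sort_insert' _ _ hb, (List.perm_orderedInsert _ _ _).countP_eq, List.countP_cons_of_neg]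
  simpa using hab.le

lemma ES_insert {N : ℕ} (a : Fin N) (s : Finset (Fin N)) (ha : a ∉ s) :
    e R a * ES R s = sg a s • ES R (insert a s) := by
  unfold ES
  rw [EL_insert _ _ (Finset.pairwise_sort _ _), sort_insert' _ _ ha, sg, zsmul_eq_mul]
  simp

lemma ES_two {N : ℕ} (a b : Fin N) (s : Finset (Fin N)) (ha : a ∉ s) (hb : b ∉ s) (h : a < b) :
    EL R (a :: b :: s.sort (· ≤ ·)) = (sg a s * sg b s) • ES R (insert a (insert b s)) := by
  rw [EL_cons, EL_cons]
  change e R a * (e R b * ES R s) = _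
  rw [ES_insert _ _ hb, mul_smul_comm, ES_insert a _ (by simp [ha, h.ne]), smul_smul,
    sg_insert _ _ _ hb h, mul_comm]

lemma ES_four {N : ℕ} (i j k l : Fin N) (s : Finset (Fin N)) (hi : i ∉ s) (hj : j ∉ s)
    (hk : k ∉ s) (hl : l ∉ s) (hij : i < j) (hjk : j < k) (hkl : k < l) :
    EL R (i :: j :: k :: l :: s.sort (· ≤ ·)) = (sg i s * sg j s * sg k s * sg l s) •
      ES R (insert i (insert j (insert k (insert l s)))) := by
  have hik := hij.trans hjk
  have hjl := hjk.trans hkl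
  have hil := hik.trans hkl
  have h1 : k ∉ insert l s := by simp [hk, hkl.ne]
  have h2 : j ∉ insert k (insert l s) := by simp [hj, hjk.ne, hjl.ne]
  have h3 : i ∉ insert j (insert k (insert l s)) := by simp [hi, hij.ne, hik.ne, hil.ne]
  rw [EL_cons, EL_cons, ES_two k l s hk hl hkl, mul_smul_comm, ES_insert _ _ h2, mul_smul_comm,
    mul_smul_comm, ES_insert _ _ h3, smul_smul, smul_smul, sg_insert i _ _ h2 hij, sg_insert i _ _ h1 hik,
    sg_insert i _ _ hl hil, sg_insert j _ _ h1 hjk, sg_insert j _ _ hl hjl]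
  congr 1; ring

lemma sg_sq {N : ℕ} (a : Fin N) (s : Finset (Fin N)) : sg a s * sg a s = 1 := by
  unfold sg
  rw [← mul_pow]; simp

lemma plucker_sorted {N : ℕ} (A : Matrix (Fin N) (Fin N) R) (i j k l : Fin N)
    (hij : i < j) (hjk : j < k) (hkl : k < l) :
    P A (ES R {i, j}ᶜ) * P A (ES R {k, l}ᶜ)
    - P A (ES R {i, k}ᶜ) * P A (ES R {j, l}ᶜ)
    + P A (ES R {i, l}ᶜ) * P A (ES R {j, k}ᶜ)
     = P A (ES R univ) * P A (ES R {i, j, k, l}ᶜ) := by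
  have hik := hij.trans hjk
  have hjl := hjk.trans hkl
  have hil := hik.trans hkl
  have key := plucker A (({i, j, k, l}ᶜ : Finset (Fin N)).sort (· ≤ ·)) i j k l
  obtain ⟨s, hs⟩ : ∃ s : Finset (Fin N), s = {i, j, k, l}ᶜ := ⟨_, rfl⟩
  rw [← hs] at key
  have hi : i ∉ s := by simp [hs]
  have hj : j ∉ s := by simp [hs]
  have hk : k ∉ s := by simp [hs]
  have hl : l ∉ s := by simp [hs]
  have e0 : (univ : Finset (Fin N)) = insert i (insert j (insert k (insert l s))) := by
    ext x; simp [hs]; tauto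
  have e1 : ({i, j}ᶜ : Finset (Fin N)) = insert k (insert l s) := by
    ext x; simp [hs]; grind
  have e2 : ({i, k}ᶜ : Finset (Fin N)) = insert j (insert l s) := by
    ext x; simp [hs]; grind
  have e3 : ({i, l}ᶜ : Finset (Fin N)) = insert j (insert k s) := by
    ext x; simp [hs]; grind
  have e4 : ({j, k}ᶜ : Finset (Fin N)) = insert i (insert l s) := by
    ext x; simp [hs]; grind
  have e5 : ({j, l}ᶜ : Finset (Fin N)) = insert i (insert k s) := by
    ext x; simp [hs]; grind
  have e6 : ({k, l}ᶜ : Finset (Fin N)) = insert i (insert j s) := by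
    ext x; simp [hs]; grind
  rw [e0, e1, e2, e3, e4, e5, e6, ← hs]
  rw [ES_four i j k l s hi hj hk hl hij hjk hkl, ES_two i j s hi hj hij, ES_two i k s hi hk hik,
    ES_two i l s hi hl hil, ES_two j k s hj hk hjk, ES_two j l s hj hl hjl, ES_two k l s hk hl hkl] at key
  change _ = _ * P A (ES R s) at key
  simp only [map_zsmul] at key
  simp only [zsmul_eq_mul, Int.cast_mul] at key
  have q : ∀ a, (sg a s : R) * sg a s = 1 := fun a => by exact_mod_cast congrArg (Int.cast : ℤ → R) (sg_sq a s)
  have q4 : ((sg i s : R) * sg j s * sg k s * sg l s) * ((sg i s : R) * sg j s * sg k s * sg l s) = 1 := by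
    calc _ = ((sg i s : R) * sg i s) * (sg j s * sg j s) * (sg k s * sg k s) * (sg l s * sg l s) := by ring
      _ = 1 := by simp [q]
  generalize P A (ES R (insert i (insert j (insert k (insert l s))))) = p0 at *
  generalize P A (ES R (insert k (insert l s))) = p1 at *
  generalize P A (ES R (insert j (insert l s))) = p2 at *
  generalize P A (ES R (insert j (insert k s))) = p3 at *
  generalize P A (ES R (insert i (insert l s))) = p4 at *
  generalize P A (ES R (insert i (insert k s))) = p5 at *
  generalize P A (ES R (insert i (insert j s))) = p6 at *
  generalize P A (ES R s) = p7 at *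
  linear_combination ((sg i s : R) * sg j s * sg k s * sg l s) * key -
    (p1 * p6 - p2 * p5 + p3 * p4 - p0 * p7) * q4


lemma contr_ofFn {N n : ℕ} (d : Module.Dual R (Fin N → R)) (v : Fin (n + 1) → Fin N) :
    contractLeft d (EL R (List.ofFn v)) =
      ∑ t : Fin (n + 1), ((-1) ^ (t : ℕ) * d (Pi.single (v t) 1)) • EL R (List.ofFn (v ∘ t.succAbove)) := by
  induction n with
  | zero => rw [List.ofFn_succ, EL_cons, contr_e]; simp
  | succ n ih =>
    rw [Fin.sum_univ_succ, List.ofFn_succ (f := v), EL_cons, contr_e, ih, sub_eq_add_neg]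
    congr 1
    · simp [Function.comp_def]
    · rw [Finset.mul_sum, ← Finset.sum_neg_distrib]
      refine Finset.sum_congr rfl fun t _ => ?_
      rw [List.ofFn_succ, EL_cons, mul_smul_comm, ← neg_smul]
      congr 1
      · simp [pow_succ]
      · simp [Function.comp_def, Fin.succ_succAbove_succ]

lemma P_ofFn {N n : ℕ} (A : Matrix (Fin N) (Fin N) R) (v : Fin (n + 2) → Fin N)
    (hv : StrictMono v) :
    P A (EL R (List.ofFn v)) = ∑ t : Fin (n + 1), (-1) ^ (t : ℕ) * A (v 0) (v t.succ) *
      P A (EL R (List.ofFn (fun a => v (t.succAbove a).succ))) := by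
  rw [List.ofFn_succ, EL_cons]
  refine (P_mul ..).trans ?_
  rw [contr_ofFn, map_sum]
  refine Finset.sum_congr rfl fun t _ => ?_
  have h : v 0 < v t.succ := hv (Fin.succ_pos t)
  rw [map_smul, bil_single, if_pos h, if_neg h.not_gt, sub_zero, smul_eq_mul]
  rfl

lemma pf_eq {n k : ℕ} (hn : n = 2 * k) (C : Matrix (Fin n) (Fin n) R) :
    pf C = ∑ π : Equiv.Perm (Fin n),
      if (∀ i : Fin k, π ⟨2 * i.val, by omega⟩ < π ⟨2 * i.val + 1, by omega⟩) ∧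
          (∀ i j : Fin k, i < j → π ⟨2 * i.val, by omega⟩ < π ⟨2 * j.val, by omega⟩) then
        ((Equiv.Perm.sign π : ℤ) : R) *
          ∏ i : Fin k, C (π ⟨2 * i.val, by omega⟩) (π ⟨2 * i.val + 1, by omega⟩)
      else 0 := by
  have hk : k = n / 2 := by omega
  subst hk
  rw [pf, dif_pos (by omega)]
  rfl

/-- Extend a permutation by prescribing the image of `0`. -/
def ext {n : ℕ} (p : Fin (n + 1)) (σ : Equiv.Perm (Fin n)) : Equiv.Perm (Fin (n + 1)) :=
  p.cycleRange.symm * Equiv.Perm.decomposeFin.symm (0, σ)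

lemma ext_zero {n : ℕ} (p : Fin (n + 1)) (σ : Equiv.Perm (Fin n)) : ext p σ 0 = p := by
  simp [ext]

lemma ext_succ {n : ℕ} (p : Fin (n + 1)) (σ : Equiv.Perm (Fin n)) (a : Fin n) :
    ext p σ a.succ = p.succAbove (σ a) := by
  simp [ext]

lemma ext_sign {n : ℕ} (p : Fin (n + 1)) (σ : Equiv.Perm (Fin n)) :
    (Equiv.Perm.sign (ext p σ) : ℤ) = (-1) ^ (p : ℕ) * Equiv.Perm.sign σ := by
  simp [ext, Equiv.Perm.sign_symm, Fin.sign_cycleRange, Equiv.Perm.decomposeFin.symm_sign]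

lemma sum_ext {n : ℕ} (f : Equiv.Perm (Fin (n + 1)) → R) :
    ∑ π, f π = ∑ p, ∑ σ, f (ext p σ) := by
  rw [← Fintype.sum_prod_type']
  symm
  refine Fintype.sum_bijective (fun x : Fin (n + 1) × Equiv.Perm (Fin n) => ext x.1 x.2)
    ((Fintype.bijective_iff_injective_and_card _).2 ⟨?_, ?_⟩) _ _ (fun _ => rfl)
  · rintro ⟨p, σ⟩ ⟨q, τ⟩ h
    simp only at h
    have h0 : p = q := by rw [← ext_zero p σ, h, ext_zero]
    subst h0
    simp only [Prod.mk.injEq, true_and]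
    ext a
    have := congrArg (fun π => π a.succ) h
    simp only [ext_succ, Fin.succAbove_right_inj] at this
    rw [this]
  · simp [Fintype.card_perm, Nat.factorial_succ]

lemma pf_rec {n k : ℕ} (hn : n = 2 * k) (C : Matrix (Fin (n + 2)) (Fin (n + 2)) R) :
    pf C = ∑ t : Fin (n + 1), (-1) ^ (t : ℕ) * C 0 t.succ *
      pf (C.submatrix (fun a => (t.succAbove a).succ) (fun a => (t.succAbove a).succ)) := by
  rw [pf_eq (k := k + 1) (by omega), sum_ext, Finset.sum_eq_single 0 _ (by simp)]
  · rw [sum_ext]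
    refine Finset.sum_congr rfl fun t _ => ?_
    rw [pf_eq hn, Finset.mul_sum]
    refine Finset.sum_congr rfl fun ρ _ => ?_
    have e0 : ext 0 (ext t ρ) ⟨2 * ((0 : Fin (k + 1)) : ℕ), by simp⟩ = 0 := ext_zero _ _
    have e1 : ext 0 (ext t ρ) ⟨2 * ((0 : Fin (k + 1)) : ℕ) + 1, by simp⟩ = t.succ := by
      refine (ext_succ 0 (ext t ρ) 0).trans ?_
      rw [ext_zero, Fin.succAbove_zero]
    have e2 : ∀ (i : Fin k), ext 0 (ext t ρ) ⟨2 * (i.succ : ℕ), by simp; omega⟩ =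
        (t.succAbove (ρ ⟨2 * i, by omega⟩)).succ := by
      intro i
      refine (ext_succ 0 (ext t ρ) (Fin.succ ⟨2 * i, by omega⟩)).trans ?_
      rw [ext_succ, Fin.succAbove_zero]
    have e3 : ∀ (i : Fin k), ext 0 (ext t ρ) ⟨2 * (i.succ : ℕ) + 1, by simp; omega⟩ =
        (t.succAbove (ρ ⟨2 * i + 1, by omega⟩)).succ := by
      intro i
      refine (ext_succ 0 (ext t ρ) (Fin.succ ⟨2 * i + 1, by omega⟩)).trans ?_
      rw [ext_succ, Fin.succAbove_zero]
    simp only [Fin.forall_fin_succ, Fin.prod_univ_succ]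
    simp only [e0, e1, e2, e3, ext_sign, Fin.succ_lt_succ_iff, Fin.succAbove_lt_succAbove_iff,
      Fin.succ_pos, lt_self_iff_false, Fin.not_lt_zero, true_and, false_imp_iff, true_imp_iff,
      implies_true, Matrix.submatrix_apply, mul_ite, mul_zero]
    congr 1
    push_cast
    simp
    ring
  · intro p _ hp
    refine Finset.sum_eq_zero fun σ _ => if_neg ?_
    rintro ⟨h1, h2⟩
    obtain ⟨a, ha⟩ := (ext p σ).surjective 0
    have h0 : ext p σ 0 = p := ext_zero p σ
    have hlo : ∀ i : Fin (k + 1), ext p σ ⟨2 * i.val, by omega⟩ ≠ 0 := by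
      intro i hi
      rcases Fin.eq_zero_or_eq_succ i with rfl | ⟨i, rfl⟩
      · exact hp (h0.symm.trans hi)
      · have := h2 0 i.succ (Fin.succ_pos i)
        rw [hi] at this
        exact Fin.not_lt_zero _ this
    rcases Nat.even_or_odd' a.val with ⟨c, hc | hc⟩
    · refine hlo ⟨c, by omega⟩ ?_
      rw [← ha]; congr 1; exact Fin.ext hc.symm
    · have := h1 ⟨c, by omega⟩
      have h3 : (⟨2 * c + 1, by omega⟩ : Fin (n + 2)) = a := Fin.ext hc.symm
      simp only [h3, ha] at this
      exact Fin.not_lt_zero _ this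

lemma pf_P {N k : ℕ} (A : Matrix (Fin N) (Fin N) R) {n : ℕ} (hn : n = 2 * k) (v : Fin n → Fin N)
    (hv : StrictMono v) : pf (A.submatrix v v) = P A (EL R (List.ofFn v)) := by
  induction k generalizing n with
  | zero =>
    obtain rfl : n = 0 := by omega
    rw [pf_eq (k := 0) rfl]
    simp [P_one]
  | succ k ih =>
    obtain ⟨n, rfl⟩ : ∃ n', n = n' + 2 := ⟨n - 2, by omega⟩
    have hn' : n = 2 * k := by omega
    rw [pf_rec hn', P_ofFn A v hv]
    refine Finset.sum_congr rfl fun t _ => ?_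
    rw [Matrix.submatrix_apply, Matrix.submatrix_submatrix]
    congr 1
    refine ih hn' _ ?_
    intro a b hab
    exact hv (Fin.succ_lt_succ_iff.2 (Fin.succAbove_lt_succAbove_iff.2 hab))

lemma ofFn_sort {N : ℕ} (s : Finset (Fin N)) :
    List.ofFn (fun i => (s.orderIsoOfFin rfl i : Fin N)) = s.sort (· ≤ ·) := by
  refine List.ext_get (by simp) fun n h1 h2 => ?_
  simp [Finset.coe_orderIsoOfFin_apply, Finset.orderEmbOfFin_apply]

lemma pf_del {N k : ℕ} (A : Matrix (Fin N) (Fin N) R) (s : Finset (Fin N))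
    (hs : sᶜ.card = 2 * k) : pf (delRC A s) = P A (ES R sᶜ) := by
  rw [ES, ← ofFn_sort]
  exact pf_P A hs _ (fun a b h => (sᶜ.orderIsoOfFin rfl).strictMono h)

lemma pf_univ {m : ℕ} (A : Matrix (Fin (2 * m)) (Fin (2 * m)) R) : pf A = P A (ES R univ) := by
  have := pf_P A rfl id strictMono_id
  rw [Matrix.submatrix_id_id] at this
  rw [this, ES]
  congr 2
  refine List.Perm.eq_of_pairwise (le := (· ≤ ·)) (fun _ _ _ _ => le_antisymm) ?_
    (Finset.pairwise_sort _ _) ?_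
  · rw [List.pairwise_ofFn]; exact fun _ _ h => h.le
  · rw [List.perm_ext_iff_of_nodup (List.nodup_ofFn.2 Function.injective_id) (Finset.sort_nodup _ _)]
    simp

end PfDJ

/-- Pfaffian analogue of the Desnanot–Jacobi identity: for a `2m × 2m` skew-symmetric
matrix `A` and row/column indices `i < j < k < l`,
`Pf A^{i,j} · Pf A^{k,l} − Pf A^{i,k} · Pf A^{j,l} + Pf A^{i,l} · Pf A^{j,k}
  = Pf A · Pf A^{i,j,k,l}`. -/
theorem pf_desnanot_jacobi {m : ℕ} (A : Matrix (Fin (2 * m)) (Fin (2 * m)) R)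
    (hA : Aᵀ = -A) (i j k l : Fin (2 * m)) (hij : i < j) (hjk : j < k) (hkl : k < l) :
    pf (delRC A {i, j}) * pf (delRC A {k, l}) - pf (delRC A {i, k}) * pf (delRC A {j, l})
      + pf (delRC A {i, l}) * pf (delRC A {j, k})
      = pf A * pf (delRC A {i, j, k, l}) := by
  have hik := hij.trans hjk
  have hjl := hjk.trans hkl
  have hil := hik.trans hkl
  have c2 : ∀ a b : Fin (2 * m), a < b → ({a, b}ᶜ : Finset (Fin (2 * m))).card = 2 * (m - 1) := by
    intro a b h
    rw [Finset.card_compl, Finset.card_pair h.ne, Fintype.card_fin]; omega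
  have c4 : ({i, j, k, l}ᶜ : Finset (Fin (2 * m))).card = 2 * (m - 2) := by
    rw [Finset.card_compl, Fintype.card_fin, Finset.card_insert_of_notMem,
      Finset.card_insert_of_notMem, Finset.card_pair hkl.ne]
    · omega
    · simp [hjk.ne, hjl.ne]
    · simp [hij.ne, hik.ne, hil.ne]
  rw [PfDJ.pf_del A _ (c2 i j hij), PfDJ.pf_del A _ (c2 i k hik), PfDJ.pf_del A _ (c2 i l hil),
    PfDJ.pf_del A _ (c2 j k hjk), PfDJ.pf_del A _ (c2 j l hjl), PfDJ.pf_del A _ (c2 k l hkl),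
    PfDJ.pf_del A _ c4, PfDJ.pf_univ]
  exact PfDJ.plucker_sorted A i j k l hij hjk hkl
end

section
/- Let Y be a skew-symmetric matrix, (a,b,c,d) a sequence of four row/column indices, and K a sequence of row/column indices of even length. Then Pf Y((a,b,c,d)⊔K) · Pf Y(K) − Pf Y((a,d)⊔K) · Pf Y((b,c)⊔K) + Pf Y((a,c)⊔K) · Pf Y((b,d)⊔K) = Pf Y((a,b)⊔K) · Pf Y((c,d)⊔K). -/
open Matrix Finset

variable {R : Type*} [CommRing R]

/-- `ppf Y I` is the Pfaffian of the principal submatrix `Y(I)` of a skew-symmetric matrix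
`Y`, with rows and columns picked (in order) from the index sequence `I`. -/
def ppf {ι : Type*} (Y : Matrix ι ι R) {k : ℕ} (I : Fin k → ι) : R :=
  pf (Y.submatrix I I)

theorem pf_eq_aux {n m : ℕ} (hm : n = 2 * m) (A : Matrix (Fin n) (Fin n) R) :
    pf A = ∑ π : Equiv.Perm (Fin n),
      if (∀ i : Fin m, π ⟨2 * i.val, by omega⟩ < π ⟨2 * i.val + 1, by omega⟩) ∧
          (∀ i j : Fin m, i < j → π ⟨2 * i.val, by omega⟩ < π ⟨2 * j.val, by omega⟩) then
        ((Equiv.Perm.sign π : ℤ) : R) *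
          ∏ i : Fin m, A (π ⟨2 * i.val, by omega⟩) (π ⟨2 * i.val + 1, by omega⟩)
      else 0 := by
  obtain rfl : m = n / 2 := by omega
  have h : n % 2 = 0 := by omega
  unfold pf
  rw [dif_pos h]
  rfl

/-- insertion of a value at the front of a permutation -/
def pfIns {n : ℕ} (x : Fin (n + 1) × Equiv.Perm (Fin n)) : Equiv.Perm (Fin (n + 1)) :=
  x.1.cycleRange.symm * Equiv.Perm.decomposeFin.symm (0, x.2)

theorem pfIns_zero {n : ℕ} (p : Fin (n + 1)) (e : Equiv.Perm (Fin n)) : pfIns (p, e) 0 = p := by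
  simp [pfIns]

theorem pfIns_succ {n : ℕ} (p : Fin (n + 1)) (e : Equiv.Perm (Fin n)) (k : Fin n) :
    pfIns (p, e) k.succ = p.succAbove (e k) := by
  simp [pfIns]

theorem pfIns_sign {n : ℕ} (p : Fin (n + 1)) (e : Equiv.Perm (Fin n)) :
    Equiv.Perm.sign (pfIns (p, e)) = (-1) ^ (p : ℕ) * Equiv.Perm.sign e := by
  simp [pfIns, Fin.sign_cycleRange]

theorem pfIns_bij {n : ℕ} : Function.Bijective (pfIns (n := n)) := by
  rw [Fintype.bijective_iff_injective_and_card]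
  constructor
  · rintro ⟨p, e⟩ ⟨q, f⟩ h
    have h0 : p = q := by rw [← pfIns_zero p e, h, pfIns_zero]
    subst h0
    congr 1
    ext k
    have := congrArg (fun g : Equiv.Perm (Fin (n + 1)) => g k.succ) h
    simp only [pfIns_succ] at this
    rw [Fin.succAbove_right_injective this]
  · simp [Fintype.card_perm, Nat.factorial_succ]

theorem pfIns_sum {n : ℕ} (f : Equiv.Perm (Fin (n + 1)) → R) :
    ∑ π, f π = ∑ p, ∑ e, f (pfIns (p, e)) := by
  rw [← Fintype.sum_prod_type']
  exact (Function.Bijective.sum_comp pfIns_bij f).symm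

theorem pf_succ {n : ℕ} (hn : n % 2 = 0) (A : Matrix (Fin (n + 2)) (Fin (n + 2)) R) :
    pf A = ∑ q : Fin (n + 1), (-1) ^ (q : ℕ) * A 0 q.succ *
      pf (A.submatrix (fun i => (q.succAbove i).succ) (fun i => (q.succAbove i).succ)) := by
  obtain ⟨m, hm⟩ : ∃ m, n = 2 * m := ⟨n / 2, by omega⟩
  rw [pf_eq_aux (m := m + 1) (by omega) A, pfIns_sum, Fintype.sum_eq_single 0, pfIns_sum]
  · refine Finset.sum_congr rfl fun q _ => ?_
    rw [pf_eq_aux (m := m) hm, Finset.mul_sum]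
    refine Finset.sum_congr rfl fun σ _ => ?_
    set π := pfIns (0, pfIns (q, σ)) with hπ
    have h0 : ∀ h, π ⟨0, h⟩ = 0 := fun h => pfIns_zero _ _
    have h1 : ∀ h, π ⟨1, h⟩ = q.succ := fun h => by
      have : (⟨1, h⟩ : Fin (n + 2)) = Fin.succ 0 := rfl
      rw [this, hπ, pfIns_succ, pfIns_zero, Fin.zero_succAbove]
    have h2 : ∀ (k : ℕ) (h : k < n) h', π ⟨k + 2, h'⟩ = (q.succAbove (σ ⟨k, h⟩)).succ := by
      intro k h h'
      have : (⟨k + 2, h'⟩ : Fin (n + 2)) = Fin.succ (Fin.succ ⟨k, h⟩) := rfl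
      rw [this, hπ, pfIns_succ, pfIns_succ, Fin.zero_succAbove]
    have hs : Equiv.Perm.sign π = (-1) ^ (q : ℕ) * Equiv.Perm.sign σ := by
      rw [hπ, pfIns_sign, pfIns_sign]; simp
    clear_value π
    have e1 : ∀ i : Fin m, π ⟨2 * i.succ.val, by omega⟩ =
        (q.succAbove (σ ⟨2 * i.val, by omega⟩)).succ := fun i => h2 _ _ _
    have e2 : ∀ i : Fin m, π ⟨2 * i.succ.val + 1, by omega⟩ =
        (q.succAbove (σ ⟨2 * i.val + 1, by omega⟩)).succ := fun i => h2 _ _ _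
    have e3 : π ⟨2 * (0 : Fin (m + 1)).val, by simp⟩ = 0 := h0 _
    have e4 : π ⟨2 * (0 : Fin (m + 1)).val + 1, by simp⟩ = q.succ := h1 _
    have hc : ((∀ i : Fin (m + 1), π ⟨2 * i.val, by omega⟩ < π ⟨2 * i.val + 1, by omega⟩) ∧
          (∀ i j : Fin (m + 1), i < j → π ⟨2 * i.val, by omega⟩ < π ⟨2 * j.val, by omega⟩)) ↔
        ((∀ i : Fin m, σ ⟨2 * i.val, by omega⟩ < σ ⟨2 * i.val + 1, by omega⟩) ∧
          (∀ i j : Fin m, i < j → σ ⟨2 * i.val, by omega⟩ < σ ⟨2 * j.val, by omega⟩)) := by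
      refine and_congr ?_ ?_
      · rw [Fin.forall_fin_succ]
        simp only [e1, e2, e3, e4, Fin.succ_pos, true_and, Fin.succ_lt_succ_iff,
          Fin.succAbove_lt_succAbove_iff]
      · simp only [Fin.forall_fin_succ (n := m)]
        simp only [e1, e2, e3, e4, Fin.succ_pos, true_and, Fin.succ_lt_succ_iff,
          Fin.succAbove_lt_succAbove_iff, lt_irrefl, Fin.not_lt_zero, false_imp_iff,
          implies_true]
    rw [if_congr hc rfl rfl, mul_ite, mul_zero]
    refine if_congr Iff.rfl ?_ rfl
    rw [Fin.prod_univ_succ]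
    simp only [e1, e2, e3, e4, hs, Matrix.submatrix_apply]
    push_cast
    ring
  · intro p hp
    refine Finset.sum_eq_zero fun e _ => if_neg ?_
    rintro ⟨c1, c2⟩
    set π := pfIns (p, e) with hπ
    obtain ⟨k, hk⟩ := π.surjective 0
    have hp0 : π 0 = p := pfIns_zero _ _
    rcases Nat.even_or_odd' k.val with ⟨i, hi | hi⟩
    · rcases Nat.eq_zero_or_pos i with h0 | h0
      · apply hp
        have hk0 : k = 0 := by
          apply Fin.ext
          simp [hi, h0]
        rw [← hp0, ← hk0, hk, hk0]
      · have := c2 0 ⟨i, by omega⟩ (by simpa [Fin.lt_def] using h0)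
        have hk' : (⟨2 * i, by omega⟩ : Fin (n + 2)) = k := Fin.ext hi.symm
        simp only [hk', hk] at this
        exact Fin.not_lt_zero _ this
    · have := c1 ⟨i, by omega⟩
      have hk' : (⟨2 * i + 1, by omega⟩ : Fin (n + 2)) = k := Fin.ext hi.symm
      simp only [hk', hk] at this
      exact Fin.not_lt_zero _ this

theorem pf_zero' (A : Matrix (Fin 0) (Fin 0) R) : pf A = 1 := by
  rw [pf_eq_aux (m := 0) rfl]
  simp

theorem pf_congr_offdiag {n : ℕ} (A B : Matrix (Fin n) (Fin n) R)
    (h : ∀ i j, i ≠ j → A i j = B i j) : pf A = pf B := by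
  unfold pf
  split_ifs with hn
  · refine Finset.sum_congr rfl fun π _ => ?_
    refine if_congr Iff.rfl ?_ rfl
    congr 1
    refine Finset.prod_congr rfl fun i _ => h _ _ ?_
    intro he
    have := π.injective he
    simp [pfLo, pfHi] at this
  · rfl

theorem ppf_cons {ι : Type*} (Y : Matrix ι ι R) {n : ℕ} (hn : n % 2 = 0) (x : ι)
    (β : Fin (n + 1) → ι) :
    ppf Y (Fin.cons x β : Fin (n + 2) → ι) =
      ∑ q : Fin (n + 1), (-1) ^ (q : ℕ) * Y x (β q) * ppf Y (fun i => β (q.succAbove i)) := by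
  unfold ppf
  rw [pf_succ hn]
  rfl

theorem contract_ιMulti {M : Type*} [AddCommGroup M] [Module R M] (d : Module.Dual R M) {n : ℕ}
    (v : Fin (n + 1) → M) :
    CliffordAlgebra.contractLeft (Q := (0 : QuadraticForm R M)) d
      (ExteriorAlgebra.ιMulti R (n + 1) v) =
      ∑ q : Fin (n + 1), ((-1) ^ (q : ℕ) * d (v q)) •
        ExteriorAlgebra.ιMulti R n (fun i => v (q.succAbove i)) := by
  induction n with
  | zero =>
    rw [ExteriorAlgebra.ιMulti_succ_apply]
    erw [CliffordAlgebra.contractLeft_ι_mul]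
    simp
    try erw [CliffordAlgebra.contractLeft_one]
    try simp
  | succ n ih =>
    rw [ExteriorAlgebra.ιMulti_succ_apply]
    erw [CliffordAlgebra.contractLeft_ι_mul]
    rw [ih, Finset.mul_sum, Fin.sum_univ_succ (n := n + 1), sub_eq_add_neg, ← Finset.sum_neg_distrib]
    congr 1
    · simp
      try rfl
    · refine Finset.sum_congr rfl fun q _ => ?_
      rw [ExteriorAlgebra.ιMulti_succ_apply]
      erw [mul_smul_comm]
      rw [← neg_smul]
      congr 1
      · simp [pow_succ, Matrix.vecTail]
      · rw [Fin.succ_succAbove_zero]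
        have : (Matrix.vecTail fun i => v (q.succ.succAbove i)) =
            fun i => Matrix.vecTail v (q.succAbove i) := by
          funext i
          simp [Matrix.vecTail]
        rw [this]
        try rfl

theorem exists_pf_functional {ι : Type*} [Fintype ι] [DecidableEq ι] (Y : Matrix ι ι R)
    (hY : ∀ i j, Y i j = - Y j i) (hd : ∀ i, Y i i = 0) :
    ∃ P : ExteriorAlgebra R (ι → R) →ₗ[R] R, ∀ n, n % 2 = 0 → ∀ I : Fin n → ι,
      P (ExteriorAlgebra.ιMulti R n (fun i => Pi.single (I i) (1 : R))) = ppf Y I := by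
  let B : LinearMap.BilinForm R (ι → R) := Matrix.toBilin' (-Y)
  have hB : B.toQuadraticMap = (0 : QuadraticForm R (ι → R)) - 0 := by
    ext v
    simp only [LinearMap.BilinMap.toQuadraticMap_apply, B, Matrix.toBilin'_apply, sub_zero,
      _root_.zero_apply]
    rw [← Fintype.sum_prod_type']
    refine Finset.sum_involution (fun x _ => (x.2, x.1)) ?_ ?_ ?_ ?_
    · rintro ⟨i, j⟩ _
      simp only [Matrix.neg_apply]
      rw [hY i j]; ring
    · rintro ⟨i, j⟩ _ h h'
      simp only [Prod.mk.injEq] at h'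
      obtain ⟨rfl, _⟩ := h'
      simp [hd] at h
    · simp
    · simp
  let ε : ExteriorAlgebra R (ι → R) →ₗ[R] R := ExteriorAlgebra.algebraMapInv.toLinearMap
  let C : ExteriorAlgebra R (ι → R) →ₗ[R] ExteriorAlgebra R (ι → R) := CliffordAlgebra.changeForm hB
  refine ⟨ε ∘ₗ C, ?_⟩
  have key : ∀ v x, (ε ∘ₗ C) (ExteriorAlgebra.ι R v * x) =
      - (ε ∘ₗ C) (CliffordAlgebra.contractLeft (Q := (0 : QuadraticForm R (ι → R))) (B v) x) := by
    intro v x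
    have h1 : C (ExteriorAlgebra.ι R v * x) = ExteriorAlgebra.ι R v * C x - 
      C (CliffordAlgebra.contractLeft (Q := (0 : QuadraticForm R (ι → R))) (B v) x) := by
      refine (CliffordAlgebra.changeForm_ι_mul hB v x).trans ?_
      rw [← CliffordAlgebra.changeForm_contractLeft]
      try rfl
    simp only [LinearMap.comp_apply, h1, map_sub]
    simp [ε, ExteriorAlgebra.algebraMapInv]
  intro n
  induction n using Nat.strong_induction_on with
  | _ n ih =>
    intro hn I
    rcases n with _ | _ | n
    · rw [ExteriorAlgebra.ιMulti_zero_apply]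
      unfold ppf
      rw [pf_zero']
      have : C 1 = 1 := CliffordAlgebra.changeForm_one hB
      simp [this, ε]
    · simp at hn
    · have hn' : n % 2 = 0 := by omega
      obtain ⟨x, β, rfl⟩ : ∃ x β, I = Fin.cons x β := ⟨I 0, Fin.tail I, (Fin.cons_self_tail I).symm⟩
      rw [ppf_cons Y hn', ExteriorAlgebra.ιMulti_succ_apply, key, contract_ιMulti, map_sum,
        ← Finset.sum_neg_distrib]
      refine Finset.sum_congr rfl fun q _ => ?_
      rw [map_smul, smul_eq_mul]
      have := ih n (by omega) hn' (fun i => β (q.succAbove i))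
      simp only [Matrix.vecTail, Function.comp, Fin.cons_succ, Fin.cons_zero] at this ⊢
      rw [this]
      have : B (Pi.single x 1) (Pi.single (β q) 1) = - Y x (β q) := by
        simp [B]
      rw [this]
      ring

theorem ppf_zero_of_eq {ι : Type*} [Fintype ι] [DecidableEq ι] (Y : Matrix ι ι R)
    (hY : ∀ i j, Y i j = - Y j i) (hd : ∀ i, Y i i = 0) {n : ℕ} (hn : n % 2 = 0)
    (I : Fin n → ι) (i j : Fin n) (hij : i ≠ j) (h : I i = I j) : ppf Y I = 0 := by
  obtain ⟨P, hP⟩ := exists_pf_functional Y hY hd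
  rw [← hP n hn, AlternatingMap.map_eq_zero_of_eq _ _ _ hij, map_zero]
  simp [h]

theorem ppf_swap {ι : Type*} [Fintype ι] [DecidableEq ι] (Y : Matrix ι ι R)
    (hY : ∀ i j, Y i j = - Y j i) (hd : ∀ i, Y i i = 0) {n : ℕ} (hn : n % 2 = 0)
    (x y : ι) (K : Fin n → ι) :
    ppf Y (Fin.cons x (Fin.cons y K : Fin (n + 1) → ι) : Fin (n + 2) → ι) =
      - ppf Y (Fin.cons y (Fin.cons x K : Fin (n + 1) → ι) : Fin (n + 2) → ι) := by
  obtain ⟨P, hP⟩ := exists_pf_functional Y hY hd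
  rw [← hP _ (by omega), ← hP _ (by omega), ← map_neg,
    ← AlternatingMap.map_swap _ _ (i := 0) (j := 1) (by simp)]
  congr 2
  funext k
  refine Fin.cases ?_ (fun k => Fin.cases ?_ (fun k => ?_) k) k
  · simp
  · simp
  · simp only [Function.comp]
    rw [Equiv.swap_apply_of_ne_of_ne]
    · simp
    · simp
    · exact fun h => Fin.succ_ne_zero k (Fin.succ_injective _ h)

theorem ppf_exchange {ι : Type*} (Y : Matrix ι ι R)
    (hY : ∀ i j, Y i j = - Y j i) {m l : ℕ} (hm : m % 2 = 0) (hl : l % 2 = 0)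
    (α : Fin (m + 1) → ι) (β : Fin (l + 1) → ι) :
    ∑ i : Fin (m + 1), (-1) ^ (i : ℕ) * ppf Y (fun k => α (i.succAbove k)) *
        ppf Y (Fin.cons (α i) β : Fin (l + 2) → ι) =
      - ∑ j : Fin (l + 1), (-1) ^ (j : ℕ) * ppf Y (fun k => β (j.succAbove k)) *
        ppf Y (Fin.cons (β j) α : Fin (m + 2) → ι) := by
  simp only [ppf_cons Y hm, ppf_cons Y hl, Finset.mul_sum]
  rw [Finset.sum_comm, ← Finset.sum_neg_distrib]
  refine Finset.sum_congr rfl fun j _ => ?_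
  rw [← Finset.sum_neg_distrib]
  refine Finset.sum_congr rfl fun i _ => ?_
  rw [hY (α i) (β j)]
  ring

theorem ppf_four {ι : Type*} [Fintype ι] [DecidableEq ι] (Y : Matrix ι ι R)
    (hY : ∀ i j, Y i j = - Y j i) (hd : ∀ i, Y i i = 0) {n : ℕ} (hn : n % 2 = 0)
    (a b c d : ι) (K : Fin n → ι) :
    ppf Y (Fin.cons a (Fin.cons b (Fin.cons c (Fin.cons d K : Fin (n + 1) → ι) : Fin (n + 2) → ι)
        : Fin (n + 3) → ι) : Fin (n + 4) → ι) * ppf Y K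
      - ppf Y (Fin.cons a (Fin.cons d K : Fin (n + 1) → ι) : Fin (n + 2) → ι) *
        ppf Y (Fin.cons b (Fin.cons c K : Fin (n + 1) → ι) : Fin (n + 2) → ι)
      + ppf Y (Fin.cons a (Fin.cons c K : Fin (n + 1) → ι) : Fin (n + 2) → ι) *
        ppf Y (Fin.cons b (Fin.cons d K : Fin (n + 1) → ι) : Fin (n + 2) → ι)
      = ppf Y (Fin.cons a (Fin.cons b K : Fin (n + 1) → ι) : Fin (n + 2) → ι) *
        ppf Y (Fin.cons c (Fin.cons d K : Fin (n + 1) → ι) : Fin (n + 2) → ι) := by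
  have hn2 : (n + 2) % 2 = 0 := by omega
  have hn4 : (n + 4) % 2 = 0 := by omega
  have H := ppf_exchange Y hY hn hn2 (Fin.cons a K)
    (Fin.cons b (Fin.cons c (Fin.cons d K : Fin (n + 1) → ι) : Fin (n + 2) → ι))
  rw [Fin.sum_univ_succ, Finset.sum_eq_zero, Fin.sum_univ_succ, Fin.sum_univ_succ,
    Fin.sum_univ_succ, Finset.sum_eq_zero] at H
  · have t0 : (fun k => (Fin.cons a K : Fin (n + 1) → ι) ((0 : Fin (n + 1)).succAbove k)) = K := by
      funext k; simp
    have t1 : (fun k => (Fin.cons b (Fin.cons c (Fin.cons d K : Fin (n + 1) → ι)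
        : Fin (n + 2) → ι) : Fin (n + 3) → ι) ((0 : Fin (n + 3)).succAbove k)) =
        (Fin.cons c (Fin.cons d K : Fin (n + 1) → ι) : Fin (n + 2) → ι) := by
      funext k; simp
    have t2 : (fun k => (Fin.cons b (Fin.cons c (Fin.cons d K : Fin (n + 1) → ι)
        : Fin (n + 2) → ι) : Fin (n + 3) → ι) ((Fin.succ 0 : Fin (n + 3)).succAbove k)) =
        (Fin.cons b (Fin.cons d K : Fin (n + 1) → ι) : Fin (n + 2) → ι) := by
      funext k
      refine Fin.cases ?_ (fun k => ?_) k
      · rw [Fin.succ_succAbove_zero]; simp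
      · rw [Fin.succ_succAbove_succ]; simp
    have t3 : (fun k => (Fin.cons b (Fin.cons c (Fin.cons d K : Fin (n + 1) → ι)
        : Fin (n + 2) → ι) : Fin (n + 3) → ι)
          ((Fin.succ (Fin.succ 0) : Fin (n + 3)).succAbove k)) =
        (Fin.cons b (Fin.cons c K : Fin (n + 1) → ι) : Fin (n + 2) → ι) := by
      funext k
      refine Fin.cases ?_ (fun k => Fin.cases ?_ (fun k => ?_) k) k
      · rw [Fin.succ_succAbove_zero]; simp
      · rw [Fin.succ_succAbove_succ, Fin.succ_succAbove_zero]; simp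
      · rw [Fin.succ_succAbove_succ, Fin.succ_succAbove_succ]; simp
    rw [t0, t1, t2, t3] at H
    simp only [Fin.cons_zero, Fin.cons_succ, Fin.val_zero, Fin.val_succ] at H
    rw [ppf_swap Y hY hd hn b a, ppf_swap Y hY hd hn c a, ppf_swap Y hY hd hn d a] at H
    linear_combination H
  · intro j _
    simp only [Fin.cons_succ]
    rw [ppf_zero_of_eq Y hY hd hn2 (Fin.cons (K j) (Fin.cons a K : Fin (n + 1) → ι)) 0 j.succ.succ (Fin.succ_ne_zero _).symm (by simp), mul_zero]
  · intro j _
    simp only [Fin.cons_succ]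
    rw [ppf_zero_of_eq Y hY hd hn4 _ 0 j.succ.succ.succ.succ (Fin.succ_ne_zero _).symm (by simp),
      mul_zero]

theorem ppf_cast {ι : Type*} (Y : Matrix ι ι R) {k l : ℕ} (h : k = l) (I : Fin k → ι)
    (J : Fin l → ι) (hIJ : ∀ i : Fin k, I i = J (Fin.cast h i)) : ppf Y I = ppf Y J := by
  subst h
  congr 1
  exact funext hIJ

theorem ppf_append_two {ι : Type*} (Y : Matrix ι ι R) {n : ℕ} (a b : ι) (K : Fin n → ι) :
    ppf Y (Fin.append ![a, b] K) =
      ppf Y (Fin.cons a (Fin.cons b K : Fin (n + 1) → ι) : Fin (n + 2) → ι) := by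
  refine ppf_cast Y (by omega) _ _ fun i => ?_
  refine Fin.addCases (fun i => ?_) (fun i => ?_) i
  · rw [Fin.append_left]
    fin_cases i <;> rfl
  · rw [Fin.append_right]
    have : Fin.cast (by omega) (Fin.natAdd 2 i) = i.succ.succ := by
      apply Fin.ext; simp; try omega
    rw [this]; simp

theorem ppf_append_four {ι : Type*} (Y : Matrix ι ι R) {n : ℕ} (a b c d : ι) (K : Fin n → ι) :
    ppf Y (Fin.append ![a, b, c, d] K) =
      ppf Y (Fin.cons a (Fin.cons b (Fin.cons c (Fin.cons d K : Fin (n + 1) → ι)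
        : Fin (n + 2) → ι) : Fin (n + 3) → ι) : Fin (n + 4) → ι) := by
  refine ppf_cast Y (by omega) _ _ fun i => ?_
  refine Fin.addCases (fun i => ?_) (fun i => ?_) i
  · rw [Fin.append_left]
    fin_cases i <;> rfl
  · rw [Fin.append_right]
    have : Fin.cast (by omega) (Fin.natAdd 4 i) = i.succ.succ.succ.succ := by
      apply Fin.ext; simp; try omega
    rw [this]; simp

/-- For a skew-symmetric matrix `Y`, indices `a, b, c, d` and a sequence `K` of even length:
`Pf Y((a,b,c,d)⊔K) · Pf Y(K) − Pf Y((a,d)⊔K) · Pf Y((b,c)⊔K)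
 + Pf Y((a,c)⊔K) · Pf Y((b,d)⊔K) = Pf Y((a,b)⊔K) · Pf Y((c,d)⊔K)`. -/
theorem pf_special22 {ι : Type*} (Y : Matrix ι ι R) (hY : Yᵀ = -Y)
    (a b c d : ι) {n : ℕ} (hn : n % 2 = 0) (K : Fin n → ι) :
    ppf Y (Fin.append ![a, b, c, d] K) * ppf Y K
      - ppf Y (Fin.append ![a, d] K) * ppf Y (Fin.append ![b, c] K)
      + ppf Y (Fin.append ![a, c] K) * ppf Y (Fin.append ![b, d] K)
      = ppf Y (Fin.append ![a, b] K) * ppf Y (Fin.append ![c, d] K) := by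
  have hY' : ∀ i j, Y i j = - Y j i := fun i j => by
    have := congrFun (congrFun hY j) i
    simpa using this
  let J : Fin 4 ⊕ Fin n → ι := Sum.elim ![a, b, c, d] K
  let X : Matrix (Fin 4 ⊕ Fin n) (Fin 4 ⊕ Fin n) R :=
    fun u v => if u = v then 0 else Y (J u) (J v)
  have hX : ∀ i j, X i j = - X j i := by
    intro i j
    simp only [X, eq_comm (a := j)]
    split_ifs
    · simp
    · exact hY' _ _
  have hXd : ∀ i, X i i = 0 := fun i => by simp [X]
  have hred : ∀ {k : ℕ} (f : Fin k → Fin 4 ⊕ Fin n) (g : Fin k → ι), Function.Injective f →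
      (∀ i, J (f i) = g i) → ppf Y g = ppf X f := by
    intro k f g hf hg
    refine pf_congr_offdiag _ _ fun i j hij => ?_
    have : X (f i) (f j) = Y (J (f i)) (J (f j)) := if_neg (hf.ne hij)
    rw [Matrix.submatrix_apply, Matrix.submatrix_apply, this, hg, hg]
  have h2 : ∀ s t : Fin 4, s ≠ t → ppf Y (Fin.append ![![a, b, c, d] s, ![a, b, c, d] t] K) =
      ppf X (Fin.append ![Sum.inl s, Sum.inl t] Sum.inr) := by
    intro s t hst
    refine hred _ _ ?_ ?_
    · rw [Fin.append_injective_iff]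
      refine ⟨?_, Sum.inr_injective, ?_⟩
      · intro i j
        fin_cases i <;> fin_cases j <;> simp [hst, hst.symm]
      · intro i j
        fin_cases i <;> simp
    · intro i
      refine Fin.addCases (fun i => ?_) (fun i => ?_) i
      · simp only [Fin.append_left]
        fin_cases i <;> rfl
      · simp only [Fin.append_right]
        rfl
  have h4 : ppf Y (Fin.append ![a, b, c, d] K) =
      ppf X (Fin.append ![Sum.inl 0, Sum.inl 1, Sum.inl 2, Sum.inl 3] Sum.inr) := by
    refine hred _ _ ?_ ?_
    · rw [Fin.append_injective_iff]
      refine ⟨?_, Sum.inr_injective, ?_⟩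
      · intro i j
        fin_cases i <;> fin_cases j <;> simp
      · intro i j
        fin_cases i <;> simp
    · intro i
      refine Fin.addCases (fun i => ?_) (fun i => ?_) i
      · simp only [Fin.append_left]
        fin_cases i <;> rfl
      · simp only [Fin.append_right]
        rfl
  have h0 : ppf Y K = ppf X Sum.inr := hred _ _ Sum.inr_injective fun i => rfl
  have hab := h2 0 1 (by decide)
  have hac := h2 0 2 (by decide)
  have had := h2 0 3 (by decide)
  have hbc := h2 1 2 (by decide)
  have hbd := h2 1 3 (by decide)
  have hcd := h2 2 3 (by decide)
  change ppf Y (Fin.append ![a, b] K) = _ at hab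
  change ppf Y (Fin.append ![a, c] K) = _ at hac
  change ppf Y (Fin.append ![a, d] K) = _ at had
  change ppf Y (Fin.append ![b, c] K) = _ at hbc
  change ppf Y (Fin.append ![b, d] K) = _ at hbd
  change ppf Y (Fin.append ![c, d] K) = _ at hcd
  rw [h4, h0, hab, hac, had, hbc, hbd, hcd]
  simp only [ppf_append_two, ppf_append_four]
  exact ppf_four X hX hXd hn _ _ _ _ _
end

section
/- (Giambelli identity) For a partition λ with Frobenius notation λ = (α_1,…,α_p | β_1,…,β_p), the Schur function satisfies s_λ = det( s_{(α_i | β_j)} )_{1≤i,j≤p}, where (a|b) denotes the hook partition (a+1, 1^b). -/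
open Matrix Finset

/-- The `k`-th complete homogeneous symmetric polynomial in `N` variables
(`0` for `k < 0`). -/
noncomputable def H (N : ℕ) (k : ℤ) : MvPolynomial (Fin N) ℤ :=
  if 0 ≤ k then MvPolynomial.hsymm (Fin N) ℤ k.toNat else 0

/-- The `k`-th elementary symmetric polynomial in `N` variables (`0` for `k < 0`). -/
noncomputable def E (N : ℕ) (k : ℤ) : MvPolynomial (Fin N) ℤ :=
  if 0 ≤ k then MvPolynomial.esymm (Fin N) ℤ k.toNat else 0

/-- The skew Schur polynomial `s_{λ/μ}` in `N` variables, given by the Jacobi–Trudi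
determinant `det (h_{λ_i − μ_j − i + j})_{1 ≤ i,j ≤ n}` (valid whenever `n ≥ l(λ)`). -/
noncomputable def skewSchur (N n : ℕ) (lam mu : ℕ → ℕ) : MvPolynomial (Fin N) ℤ :=
  (Matrix.of fun i j : Fin n =>
    H N ((lam i.1 : ℤ) - (mu j.1 : ℤ) - (i.1 : ℤ) + (j.1 : ℤ))).det

/-- The partition `λ = (α_1,…,α_p | β_1,…,β_p)` determined by Frobenius coordinates:
`λ_i = α_i + i` for `1 ≤ i ≤ p` (here `0`-indexed), and for `i > p` the `i`-th part is the
number of columns `j ≤ p` whose length `β_j + j` still reaches row `i`. -/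
def frobPart {p : ℕ} (a b : Fin p → ℕ) : ℕ → ℕ := fun i =>
  if h : i < p then a ⟨i, h⟩ + i + 1
  else (Finset.univ.filter fun j : Fin p => i ≤ b j + (j : ℕ)).card

/-- The Schur polynomial of the hook partition `(a | b) = (a+1, 1^b)`. -/
noncomputable def hookSchur (N : ℕ) (a b : ℕ) : MvPolynomial (Fin N) ℤ :=
  skewSchur N (b + 1) (frobPart (fun _ : Fin 1 => a) (fun _ : Fin 1 => b)) (fun _ => 0)

theorem gia_lt_iff {p : ℕ} (β : Fin p → ℕ) (hβ : StrictAnti β) (i : ℕ) (j : Fin p) :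
    (j : ℕ) < (Finset.univ.filter fun l : Fin p => i ≤ β l + (l : ℕ)).card ↔ i ≤ β j + (j : ℕ) := by
  have hm : ∀ l l' : Fin p, l ≤ l' → β l' + (l' : ℕ) ≤ β l + (l : ℕ) := by
    have key : ∀ d : ℕ, ∀ l l' : Fin p, (l' : ℕ) = l + d → β l' + (l' : ℕ) ≤ β l + (l : ℕ) := by
      intro d
      induction d with
      | zero =>
        intro l l' h
        have : l' = l := Fin.ext (by omega)
        rw [this]
      | succ d ih =>
        intro l l' h
        have h1 := ih l ⟨l + d, by omega⟩ rfl
        have h2 : β l' < β ⟨l + d, by omega⟩ := hβ (by rw [Fin.lt_def]; simp; omega)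
        simp only at h1
        omega
    intro l l' h
    exact key (l' - l) l l' (by rw [Fin.le_def] at h; omega)
  constructor
  · intro h
    by_contra hc
    have hsub : (Finset.univ.filter fun l : Fin p => i ≤ β l + (l : ℕ)) ⊆ Finset.Iio j := by
      intro l hl
      simp only [Finset.mem_filter, Finset.mem_univ, true_and] at hl
      rw [Finset.mem_Iio]
      by_contra hlj
      have := hm j l (not_lt.mp hlj)
      omega
    have := Finset.card_le_card hsub
    rw [Fin.card_Iio] at this
    omega
  · intro h
    have hsub : Finset.Iic j ⊆ (Finset.univ.filter fun l : Fin p => i ≤ β l + (l : ℕ)) := by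
      intro l hl
      rw [Finset.mem_Iic] at hl
      simp only [Finset.mem_filter, Finset.mem_univ, true_and]
      have := hm l j hl
      omega
    have := Finset.card_le_card hsub
    rw [Fin.card_Iic] at this
    omega

/-- coefficients -/
noncomputable def giaC {R : Type*} [CommRing R] (h : ℤ → R) (a : ℕ) (b : ℕ) : R :=
  h (a + 1 + b) - ∑ k : Fin b, giaC h a k.1 * h ((b : ℤ) - (k.1 : ℤ))
termination_by b
decreasing_by exact k.2

theorem giaC_sum {R : Type*} [CommRing R] (h : ℤ → R) (h0 : h 0 = 1) (hneg : ∀ k < 0, h k = 0)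
    (a n : ℕ) (j : Fin n) :
    ∑ k : Fin n, giaC h a k.1 * h ((j.1 : ℤ) - (k.1 : ℤ)) = h (a + 1 + j.1) := by
  rw [Fin.sum_univ_eq_sum_range (fun k => giaC h a k * h ((j.1 : ℤ) - (k : ℤ))) n]
  have hs : Finset.range (j.1 + 1) ⊆ Finset.range n := by
    intro x hx
    rw [Finset.mem_range] at *
    have := j.2
    omega
  rw [← Finset.sum_subset hs]
  · rw [Finset.sum_range_succ, giaC,
      Fin.sum_univ_eq_sum_range (fun k => giaC h a k * h ((j.1 : ℤ) - (k : ℤ))) j.1]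
    simp [h0]
  · intro x _ hx
    rw [Finset.mem_range] at hx
    rw [hneg _ (by omega), mul_zero]

theorem gia_sign {p n : ℕ} (σ : Equiv.Perm (Fin n)) 
    (h1 : ∀ i j : Fin n, i < j → j.1 < p → σ j < σ i)
    (h2 : ∀ i j : Fin n, i < j → p ≤ i.1 → σ i < σ j) :
    (Equiv.Perm.sign σ : ℤˣ) = ∏ i : Fin n, if i.1 < p then (-1) ^ (σ i).1 else 1 := by
  rw [Equiv.Perm.sign_eq_prod_prod_Ioi]
  refine Finset.prod_congr rfl fun i _ => ?_
  split_ifs with hi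
  · rw [Finset.prod_ite, Finset.prod_const_one, one_mul, Finset.prod_const]
    congr 1
    have : (Finset.filter (fun x => ¬ σ i < σ x) (Finset.Ioi i)).map σ.toEmbedding
        = Finset.Iio (σ i) := by
      ext y
      simp only [Finset.mem_map_equiv, Finset.mem_filter, Finset.mem_Ioi, Finset.mem_Iio,
        Equiv.apply_symm_apply, not_lt]
      constructor
      · rintro ⟨ha, hb⟩
        refine lt_of_le_of_ne hb ?_
        rintro rfl
        simp at ha
      · intro hy
        refine ⟨?_, hy.le⟩
        by_contra hc
        rcases lt_or_eq_of_le (not_lt.mp hc) with hc | hc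
        · have := h1 _ _ hc hi
          rw [Equiv.apply_symm_apply] at this
          exact absurd hy (not_lt.mpr this.le)
        · rw [← hc, Equiv.apply_symm_apply] at hy
          exact lt_irrefl _ hy
    rw [← Finset.card_map σ.toEmbedding, this, Fin.card_Iio]
  · refine Finset.prod_eq_one fun j hj => ?_
    rw [if_pos (h2 i j (Finset.mem_Ioi.mp hj) (not_lt.mp hi))]

theorem gia_main {R : Type*} [CommRing R] (h : ℤ → R) (h0 : h 0 = 1) (hneg : ∀ k < 0, h k = 0)
    {p n : ℕ} (α β : Fin p → ℕ) (hβ : StrictAnti β)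
    (hn : ∀ i, n ≤ i → frobPart α β i = 0) :
    (Matrix.of fun i j : Fin n => h ((frobPart α β i.1 : ℤ) - (i.1 : ℤ) + (j.1 : ℤ))).det
      = (∏ j : Fin p, (-1 : R) ^ β j) * (Matrix.of fun i j : Fin p => giaC h (α i) (β j)).det := by
  have hpn : p ≤ n := by
    by_contra hc
    have := hn n le_rfl
    rw [frobPart, dif_pos (not_le.mp hc)] at this
    omega
  obtain ⟨m, rfl⟩ := Nat.exists_eq_add_of_le hpn
  have hbn : ∀ j, β j + (j : ℕ) < p + m := by
    intro j
    have := hn (p + m) le_rfl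
    rw [frobPart, dif_neg (by omega)] at this
    by_contra hc
    have := (gia_lt_iff β hβ (p + m) j).mpr (by omega)
    omega
  have hlow : ∀ i : ℕ, p ≤ i → frobPart α β i =
      (Finset.univ.filter fun l : Fin p => i ≤ β l + (l : ℕ)).card := by
    intro i hi
    rw [frobPart, dif_neg (by omega)]
  have hlp : ∀ i : ℕ, p ≤ i → frobPart α β i ≤ p := by
    intro i hi
    rw [hlow i hi]
    exact (Finset.card_le_univ _).trans (by simp)
  have hlanti : ∀ i i' : ℕ, p ≤ i → i ≤ i' → frobPart α β i' ≤ frobPart α β i := by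
    intro i i' hi hii
    rw [hlow i hi, hlow i' (by omega)]
    apply Finset.card_le_card
    intro l
    simp only [Finset.mem_filter, Finset.mem_univ, true_and]
    omega
  let f : Fin (p + m) → Fin (p + m) := fun i =>
    if hi : i.1 < p then ⟨β ⟨i.1, hi⟩, by have := hbn ⟨i.1, hi⟩; omega⟩
    else ⟨i.1 - frobPart α β i.1, by omega⟩
  have f1 : ∀ (i : Fin (p + m)) (hi : i.1 < p), (f i).1 = β ⟨i.1, hi⟩ := by
    intro i hi
    simp only [f, dif_pos hi]
  have f2 : ∀ (i : Fin (p + m)) (_ : p ≤ i.1), (f i).1 = i.1 - frobPart α β i.1 := by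
    intro i hi
    simp only [f, dif_neg (not_lt.mpr hi)]
  have g1 : ∀ i j : Fin (p + m), i < j → j.1 < p → f j < f i := by
    intro i j hij hj
    rw [Fin.lt_def] at hij
    rw [Fin.lt_def, f1 j hj, f1 i (by omega)]
    exact hβ hij
  have g2 : ∀ i j : Fin (p + m), i < j → p ≤ i.1 → f i < f j := by
    intro i j hij hi
    rw [Fin.lt_def] at hij
    rw [Fin.lt_def, f2 i hi, f2 j (by omega)]
    have := hlanti i j hi hij.le
    have := hlp i hi
    omega
  have finj : Function.Injective f := by
    have key : ∀ i j : Fin (p + m), i < j → f i ≠ f j := by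
      intro i j hij he
      rcases lt_or_ge j.1 p with hj | hj
      · exact absurd he (g1 i j hij hj).ne'
      rcases le_or_gt p i.1 with hi | hi
      · exact absurd he (g2 i j hij hi).ne
      have he' : (f i).1 = (f j).1 := by rw [he]
      rw [f1 i hi, f2 j hj] at he'
      have hk := gia_lt_iff β hβ j.1 ⟨i.1, hi⟩
      rw [← hlow j.1 hj] at hk
      have := hlp j.1 hj
      simp only at hk
      omega
    intro i j hij
    rcases lt_trichotomy i j with hl | hl | hl
    · exact absurd hij (key i j hl)
    · exact hl
    · exact absurd hij.symm (key j i hl)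
  let σ : Equiv.Perm (Fin (p + m)) := Equiv.ofBijective f (Finite.injective_iff_bijective.mp finj)
  have hσ : ∀ i, σ i = f i := fun i => rfl
  let C : Matrix (Fin (p + m)) (Fin (p + m)) R := Matrix.of fun i k =>
    if hi : i.1 < p then giaC h (α ⟨i.1, hi⟩) k.1 else if k = f i then 1 else 0
  let T : Matrix (Fin (p + m)) (Fin (p + m)) R := Matrix.of fun k j =>
    h ((j.1 : ℤ) - (k.1 : ℤ))
  have hM : (Matrix.of fun i j : Fin (p + m) =>
      h ((frobPart α β i.1 : ℤ) - (i.1 : ℤ) + (j.1 : ℤ))) = C * T := by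
    ext i j
    rw [Matrix.mul_apply]
    simp only [C, T, Matrix.of_apply]
    by_cases hi : i.1 < p
    · simp only [dif_pos hi]
      rw [giaC_sum h h0 hneg, frobPart, dif_pos hi]
      congr 1
      push_cast
      ring
    · simp only [dif_neg hi, ite_mul, one_mul, zero_mul, Finset.sum_ite_eq', Finset.sum_ite_eq,
        Finset.mem_univ, if_true]
      rw [f2 i (by omega)]
      have := hlp i.1 (by omega)
      congr 1
      omega
  have hT : T.det = 1 := by
    rw [Matrix.det_of_upperTriangular]
    · simp [T, h0]
    · intro i j hij
      have : j.1 < i.1 := hij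
      simp only [T, Matrix.of_apply]
      exact hneg _ (by omega)
  have hs := gia_sign (p := p) σ g1 g2
  have hs' : ((Equiv.Perm.sign σ : ℤˣ) : ℤ) = ∏ j : Fin p, (-1 : ℤ) ^ β j := by
    rw [hs, Fin.prod_univ_add]
    simp [hσ, f]
  have hC : (C.submatrix id σ).det = (Matrix.of fun i j : Fin p => giaC h (α i) (β j)).det := by
    rw [← Matrix.det_submatrix_equiv_self finSumFinEquiv]
    rw [← Matrix.fromBlocks_toBlocks ((C.submatrix id σ).submatrix finSumFinEquiv finSumFinEquiv)]
    have b21 : ((C.submatrix id σ).submatrix finSumFinEquiv finSumFinEquiv).toBlocks₂₁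
        = (0 : Matrix (Fin m) (Fin p) R) := by
      ext i j
      simp [Matrix.toBlocks₂₁, C, hσ, finj.eq_iff]
      intro hh
      have := congrArg Fin.val hh
      simp at this
      omega
    have b22 : ((C.submatrix id σ).submatrix finSumFinEquiv finSumFinEquiv).toBlocks₂₂
        = (1 : Matrix (Fin m) (Fin m) R) := by
      ext i j
      simp [Matrix.toBlocks₂₂, C, hσ, finj.eq_iff, Matrix.one_apply, eq_comm]
    rw [b21, b22, Matrix.det_fromBlocks_zero₂₁, Matrix.det_one, mul_one]
    congr 1
    ext i j
    simp [Matrix.toBlocks₁₁, C, hσ, f]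
  rw [Matrix.det_permute', hs'] at hC
  rw [hM, Matrix.det_mul, hT, mul_one, ← hC, ← mul_assoc]
  push_cast
  rw [← Finset.prod_mul_distrib]
  simp [← mul_pow]

theorem giambelli (N : ℕ) {p n : ℕ} (α β : Fin p → ℕ)
    (hα : StrictAnti α) (hβ : StrictAnti β)
    (hn : ∀ i, n ≤ i → frobPart α β i = 0) :
    skewSchur N n (frobPart α β) (fun _ => 0)
      = (Matrix.of fun i j : Fin p => hookSchur N (α i) (β j)).det := by
  have h0 : H N 0 = 1 := by simp [H]
  have hneg : ∀ k < 0, H N k = 0 := by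
    intro k hk
    rw [H, if_neg (by omega)]
  have hhook : ∀ a b : ℕ, hookSchur N a b = (-1) ^ b * giaC (H N) a b := by
    intro a b
    have := gia_main (H N) h0 hneg (p := 1) (n := b + 1) (fun _ => a) (fun _ => b)
      (Subsingleton.strictAnti _) (by
        intro i hi
        rw [frobPart, dif_neg (by omega)]
        simp
        omega)
    simp only [hookSchur, skewSchur, Nat.cast_zero, sub_zero]
    rw [this]
    simp
  simp only [skewSchur, Nat.cast_zero, sub_zero]
  rw [gia_main (H N) h0 hneg α β hβ hn, ← Matrix.det_mul_row]
  congr 1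
  ext i j : 2
  simp [hhook]
end

section
/- (Skew Schur Q-function Pfaffian identity) Let λ and μ be strict partitions with l = l(λ), m = l(μ), and set s = m if l+m is even and s = m+1 (appending μ_{m+1} = 0) if l+m is odd. Then Q_{λ/μ} = Pf of the (l+s)×(l+s) skew-symmetric matrix whose (i,j) entry for 1≤i<j≤l is Q_{(λ_i,λ_j,μ_1,…,μ_m)/μ}, whose (i, l+j) entry for 1≤i≤l, 1≤j≤s is Q_{(λ_i,μ_1,…,μ̂_j,…,μ_s)/μ}, and whose bottom-right s×s block is zero; here μ̂_j denotes omission of μ_j. -/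
open Matrix Finset

variable {R : Type*} [CommRing R]

/-- The sequence obtained from `J : Fin q → ι` by removing its entry at position `β`. -/
def removeAt {ι : Type*} {q : ℕ} (J : Fin q → ι) (β : Fin q) (i : Fin (q - 1)) : ι :=
  J (Fin.cast (by have := β.isLt; omega : q - 1 + 1 = q)
      ((Fin.cast (by have := β.isLt; omega : q = q - 1 + 1) β).succAbove i))

/-- The one-row Schur `Q`-polynomial `q_k = ∑_{i≤k} e_i h_{k−i}` in `N` variables
(with generating function `∏_i (1+x_i t)/(1−x_i t)`). -/
noncomputable def qQ (N : ℕ) (k : ℕ) : MvPolynomial (Fin N) ℤ :=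
  ∑ i ∈ Finset.range (k + 1),
    MvPolynomial.esymm (Fin N) ℤ i * MvPolynomial.hsymm (Fin N) ℤ (k - i)

/-- `Q_{(a)}` for an integer `a`, which is `0` for `a < 0`. -/
noncomputable def Qone (N : ℕ) (k : ℤ) : MvPolynomial (Fin N) ℤ :=
  if 0 ≤ k then qQ N k.toNat else 0

/-- The two-row Schur `Q`-function `Q_{(a,b)}`, with the conventions
`Q_{(a,b)} = −Q_{(b,a)}`, `Q_{(a,0)} = −Q_{(0,a)} = Q_{(a)}` and `Q_{(0,0)} = 0`;
for `a, b ≥ 1` it is given by `q_a q_b + 2 ∑_{i=1}^{b} (−1)^i q_{a+i} q_{b−i}`. -/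
noncomputable def Qpair (N : ℕ) (a b : ℕ) : MvPolynomial (Fin N) ℤ :=
  if a = 0 ∧ b = 0 then 0
  else if b = 0 then qQ N a
  else if a = 0 then -qQ N b
  else qQ N a * qQ N b + 2 * ∑ i ∈ Finset.Icc 1 b, (-1) ^ i * qQ N (a + i) * qQ N (b - i)

/-- The Józefiak–Pragacz Pfaffian `Pf [[ S^α_α, T^α_ν ], [ −(T^α_ν)ᵀ, O ]]`, where
`S^α_α = (Q_{(α_i,α_j)})` and `T^α_ν = (Q_{(α_i − ν_{s+1−j})})` (columns of `T` reversed). -/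
noncomputable def QJP (N : ℕ) {l s : ℕ} (α : Fin l → ℕ) (ν : Fin s → ℕ) :
    MvPolynomial (Fin N) ℤ :=
  pf ((Matrix.fromBlocks
    (Matrix.of fun i j : Fin l => Qpair N (α i) (α j))
    (Matrix.of fun (i : Fin l) (j : Fin s) => Qone N ((α i : ℤ) - (ν (Fin.rev j) : ℤ)))
    (-(Matrix.of fun (i : Fin l) (j : Fin s) =>
        Qone N ((α i : ℤ) - (ν (Fin.rev j) : ℤ)))ᵀ)
    0).submatrix finSumFinEquiv.symm finSumFinEquiv.symm)

/-- The (extended) skew Schur `Q`-function `Q_{α/μ}` of a sequence `α` of length `l` and a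
strict partition `μ` of length `m`, given by the Józefiak–Pragacz Pfaffian, where a zero
part is appended to `μ` when `l + m` is odd. -/
noncomputable def QExt (N : ℕ) {l m : ℕ} (α : Fin l → ℕ) (μ : Fin m → ℕ) :
    MvPolynomial (Fin N) ℤ :=
  if (l + m) % 2 = 0 then QJP N α μ else QJP N α (Fin.snoc μ 0)

/-- The right-hand side of the skew Schur identity: the Pfaffian of the `(l+s) × (l+s)`
skew-symmetric matrix whose `(i,j)` entry for `i < j ≤ l` is `Q_{(λ_i,λ_j,μ_1,…,μ_m)/μ}`,
whose `(i, l+j)` entry is `Q_{(λ_i,μ_1,…,μ̂_j,…,μ_s)/μ}`, and whose bottom-right `s × s`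
block is zero; here `μs` is `μ`, possibly extended by a zero part. -/
noncomputable def skewQRHS (N : ℕ) {l m s : ℕ} (lam : Fin l → ℕ) (μ : Fin m → ℕ)
    (μs : Fin s → ℕ) : MvPolynomial (Fin N) ℤ :=
  pf ((Matrix.fromBlocks
    (Matrix.of fun i j : Fin l =>
      if i < j then QExt N (Fin.cons (lam i) (Fin.cons (lam j) μ)) μ
      else if j < i then -QExt N (Fin.cons (lam j) (Fin.cons (lam i) μ)) μ
      else 0)
    (Matrix.of fun (i : Fin l) (j : Fin s) =>
      QExt N ((Fin.cons (lam i) (removeAt μs j)) ∘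
        Fin.cast (by have := j.isLt; omega : s = s - 1 + 1)) μ)
    (-(Matrix.of fun (i : Fin l) (j : Fin s) =>
      QExt N ((Fin.cons (lam i) (removeAt μs j)) ∘
        Fin.cast (by have := j.isLt; omega : s = s - 1 + 1)) μ)ᵀ)
    0).submatrix finSumFinEquiv.symm finSumFinEquiv.symm)

set_option linter.all false
set_option linter.unusedSimpArgs false
set_option linter.unusedSectionVars false
set_option linter.unusedTactic false
section PfTheory

def bpf {n : ℕ} (h : n % 2 = 0) (A : Matrix (Fin n) (Fin n) R) : R :=
  ∑ π : Equiv.Perm (Fin n), ((Equiv.Perm.sign π : ℤ) : R) *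
    ∏ i : Fin (n / 2), A (π (pfLo h i)) (π (pfHi h i))

def pfE {n : ℕ} (h : n % 2 = 0) : Fin (n / 2) × Fin 2 ≃ Fin n :=
  finProdFinEquiv.trans (finCongr (by omega))

lemma pfE_zero {n : ℕ} (h : n % 2 = 0) (i : Fin (n / 2)) : pfE h (i, 0) = pfLo h i := by
  ext; simp [pfE, pfLo, finProdFinEquiv]

lemma pfE_one {n : ℕ} (h : n % 2 = 0) (i : Fin (n / 2)) : pfE h (i, 1) = pfHi h i := by
  ext; simp [pfE, pfHi, finProdFinEquiv]; omega

/-- Pair-preserving permutations. -/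
def pfH {k : ℕ} (x : Equiv.Perm (Fin k) × (Fin k → Equiv.Perm (Fin 2))) :
    Equiv.Perm (Fin k × Fin 2) :=
  (Equiv.prodCongrLeft (fun _ => x.1)).trans (Equiv.prodCongrRight x.2)

lemma pfH_apply {k : ℕ} (x : Equiv.Perm (Fin k) × (Fin k → Equiv.Perm (Fin 2))) (i : Fin k)
    (a : Fin 2) : pfH x (i, a) = (x.1 i, x.2 (x.1 i) a) := rfl

lemma sign_pfH {k : ℕ} (x : Equiv.Perm (Fin k) × (Fin k → Equiv.Perm (Fin 2))) :
    Equiv.Perm.sign (pfH x) = ∏ i, Equiv.Perm.sign (x.2 i) := by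
  unfold pfH
  rw [Equiv.Perm.sign_trans, Equiv.Perm.sign_prodCongrRight, Equiv.Perm.sign_prodCongrLeft]
  simp

def pfG {n : ℕ} (h : n % 2 = 0)
    (x : Equiv.Perm (Fin (n/2)) × (Fin (n/2) → Equiv.Perm (Fin 2))) : Equiv.Perm (Fin n) :=
  (pfE h).permCongr (pfH x)

lemma pfG_lo {n : ℕ} (h : n % 2 = 0) (x) (i : Fin (n/2)) :
    pfG h x (pfLo h i) = pfE h (x.1 i, x.2 (x.1 i) 0) := by
  rw [← pfE_zero, pfG, Equiv.permCongr_apply, Equiv.symm_apply_apply, pfH_apply]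

lemma pfG_hi {n : ℕ} (h : n % 2 = 0) (x) (i : Fin (n/2)) :
    pfG h x (pfHi h i) = pfE h (x.1 i, x.2 (x.1 i) 1) := by
  rw [← pfE_one, pfG, Equiv.permCongr_apply, Equiv.symm_apply_apply, pfH_apply]

lemma perm2 (p : Equiv.Perm (Fin 2)) : p = 1 ∨ p = Equiv.swap 0 1 := by
  revert p; decide

lemma pf_term {n : ℕ} (h : n % 2 = 0) (A : Matrix (Fin n) (Fin n) R)
    (hA : ∀ i j, A j i = - A i j) (x) (π : Equiv.Perm (Fin n)) :
    ((Equiv.Perm.sign (π * pfG h x) : ℤ) : R) *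
      ∏ i : Fin (n / 2), A ((π * pfG h x) (pfLo h i)) ((π * pfG h x) (pfHi h i)) =
    ((Equiv.Perm.sign π : ℤ) : R) *
      ∏ i : Fin (n / 2), A (π (pfLo h i)) (π (pfHi h i)) := by
  simp only [Equiv.Perm.mul_apply, pfG_lo, pfG_hi]
  rw [Equiv.prod_comp x.1 (fun j => A (π (pfE h (j, x.2 j 0))) (π (pfE h (j, x.2 j 1))))]
  have : ∀ j, A (π (pfE h (j, x.2 j 0))) (π (pfE h (j, x.2 j 1))) =
      ((Equiv.Perm.sign (x.2 j) : ℤ) : R) * A (π (pfLo h j)) (π (pfHi h j)) := by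
    intro j
    rcases perm2 (x.2 j) with hp | hp <;> rw [hp]
    · simp [pfE_zero, pfE_one]
    · rw [Equiv.Perm.sign_swap (by decide)]
      simp [pfE_zero, pfE_one, hA (π (pfLo h j))]
  simp only [this]
  rw [Finset.prod_mul_distrib, Equiv.Perm.sign_mul]
  have hs : Equiv.Perm.sign (pfG h x) = ∏ i, Equiv.Perm.sign (x.2 i) := by
    rw [pfG, Equiv.Perm.sign_permCongr, sign_pfH]
  have h2 : ((∏ i, Equiv.Perm.sign (x.2 i) : ℤˣ) : ℤ) * ((∏ i, Equiv.Perm.sign (x.2 i) : ℤˣ) : ℤ) = 1 := by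
    rw [← Units.val_mul, Int.units_mul_self]; rfl
  have h3 : (((∏ i, Equiv.Perm.sign (x.2 i) : ℤˣ) : ℤ) : R) * (((∏ i, Equiv.Perm.sign (x.2 i) : ℤˣ) : ℤ) : R) = 1 := by
    rw [← Int.cast_mul, h2]; simp
  rw [hs]
  have h4 : ∏ i, (((Equiv.Perm.sign (x.2 i) : ℤˣ) : ℤ) : R) = (((∏ i, Equiv.Perm.sign (x.2 i) : ℤˣ) : ℤ) : R) := by
    push_cast; rfl
  rw [h4, Units.val_mul, Int.cast_mul]
  linear_combination (((Equiv.Perm.sign π : ℤ) : R) *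
      ∏ i : Fin (n / 2), A (π (pfLo h i)) (π (pfHi h i))) * h3

def pfStd {n : ℕ} (h : n % 2 = 0) (π : Equiv.Perm (Fin n)) : Prop :=
  (∀ i : Fin (n / 2), π (pfLo h i) < π (pfHi h i)) ∧
          (∀ i j : Fin (n / 2), i < j → π (pfLo h i) < π (pfLo h j))

lemma exists_unique_sort {n : ℕ} (h : n % 2 = 0) (π : Equiv.Perm (Fin n)) :
    ∃! x, pfStd h (π * pfG h x) := by
  have hb : ∀ j : Fin (n/2), ∃ p : Equiv.Perm (Fin 2),
      π (pfE h (j, p 0)) < π (pfE h (j, p 1)) := by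
    intro j
    have hne : π (pfE h (j, 0)) ≠ π (pfE h (j, 1)) := by simp
    rcases lt_or_gt_of_ne hne with h1 | h1
    · exact ⟨1, by simpa using h1⟩
    · exact ⟨Equiv.swap 0 1, by simpa using h1⟩
  choose b hb using hb
  have hbu : ∀ j (p : Equiv.Perm (Fin 2)), π (pfE h (j, p 0)) < π (pfE h (j, p 1)) → p = b j := by
    intro j p hp
    have h1 := hb j
    rcases perm2 p with h2 | h2 <;> rcases perm2 (b j) with h3 | h3 <;> rw [h2] at hp ⊢ <;>
      rw [h3] at h1 ⊢ <;> simp at h1 hp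
    · exact absurd hp h1.le.not_gt
    · exact absurd hp h1.le.not_gt
  set f : Fin (n/2) → Fin n := fun j => π (pfE h (j, b j 0)) with hf
  have finj : Function.Injective f := by
    intro i j hij
    have := (pfE h).injective (π.injective hij)
    exact (Prod.ext_iff.1 this).1
  have hmono : Monotone (f ∘ Tuple.sort f) := Tuple.monotone_sort f
  refine ⟨(Tuple.sort f, b), ?_, ?_⟩
  · refine ⟨?_, ?_⟩
    · intro i
      simp only [Equiv.Perm.mul_apply, pfG_lo, pfG_hi]
      exact hb _
    · intro i j hij
      simp only [Equiv.Perm.mul_apply, pfG_lo]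
      exact (hmono.strictMono_of_injective (finj.comp (Tuple.sort f).injective)) hij
  · rintro ⟨τ, b'⟩ ⟨h1, h2⟩
    simp only [Equiv.Perm.mul_apply, pfG_lo, pfG_hi] at h1 h2
    have hb' : b' = b := by
      funext j
      apply hbu
      have := h1 (τ.symm j)
      simpa using this
    subst hb'
    congr 1
    have hm : Monotone (f ∘ τ) := (show StrictMono (f ∘ τ) from fun i j hij => h2 i j hij).monotone
    have := Tuple.unique_monotone hm hmono
    ext i
    exact congrArg Fin.val (finj (congrFun this i))

lemma bpf_eq {n : ℕ} (h : n % 2 = 0) (A : Matrix (Fin n) (Fin n) R)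
    (hA : ∀ i j, A j i = - A i j) :
    bpf h A = (Fintype.card (Equiv.Perm (Fin (n/2)) × (Fin (n/2) → Equiv.Perm (Fin 2))) : R) * pf A := by
  classical
  set F : Equiv.Perm (Fin n) → R := fun π => ((Equiv.Perm.sign π : ℤ) : R) *
    ∏ i : Fin (n / 2), A (π (pfLo h i)) (π (pfHi h i)) with hF
  have hp : pf A = ∑ π, if pfStd h π then F π else 0 := by
    rw [pf, dif_pos h]
    refine Finset.sum_congr rfl fun π _ => ?_
    simp only [pfStd, hF]
  have h1 : bpf h A = ∑ π, ∑ x, if pfStd h (π * pfG h x) then F (π * pfG h x) else 0 := by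
    refine Finset.sum_congr rfl fun π _ => ?_
    obtain ⟨x, hx, hu⟩ := exists_unique_sort h π
    rw [Finset.sum_eq_single x]
    · rw [if_pos hx]; exact (pf_term h A hA x π).symm
    · intro y _ hy
      rw [if_neg]
      exact fun hh => hy (hu y hh)
    · simp
  rw [h1, Finset.sum_comm]
  have h2 : ∀ x, (∑ π, if pfStd h (π * pfG h x) then F (π * pfG h x) else 0) = pf A := by
    intro x
    rw [hp]
    exact Equiv.sum_comp (Equiv.mulRight (pfG h x)) (fun π => if pfStd h π then F π else 0)
  simp only [h2]
  simp [Finset.sum_const]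

lemma bpf_conj {n : ℕ} (h : n % 2 = 0) (A P : Matrix (Fin n) (Fin n) R) :
    bpf h (P * A * Pᵀ) = P.det * bpf h A := by
  have key : ∀ B : Matrix (Fin n) (Fin n) R, ∀ π : Equiv.Perm (Fin n),
    ∏ i : Fin (n / 2), (P * B * Pᵀ) (π (pfLo h i)) (π (pfHi h i)) =
      ∑ f : Fin n → Fin n, (∏ i : Fin (n/2), B (f (pfLo h i)) (f (pfHi h i))) *
        ∏ j, P (π j) (f j) := by
    intro B π
    have e1 : ∀ i : Fin (n/2), (P * B * Pᵀ) (π (pfLo h i)) (π (pfHi h i)) =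
        ∑ g : Fin 2 → Fin n, B (g 0) (g 1) * ∏ a : Fin 2, P (π (pfE h (i, a))) (g a) := by
      intro i
      rw [← (finTwoArrowEquiv (Fin n)).symm.sum_comp, Fintype.sum_prod_type]
      simp only [Matrix.mul_apply, Finset.sum_mul, Matrix.transpose_apply]
      rw [Finset.sum_comm]
      refine Finset.sum_congr rfl fun a _ => Finset.sum_congr rfl fun b _ => ?_
      simp [Fin.prod_univ_two, pfE_zero, pfE_one]
      ring
    simp only [e1]
    rw [Finset.prod_univ_sum, Fintype.piFinset_univ]
    rw [← (Equiv.arrowCongr (pfE h) (Equiv.refl (Fin n))).sum_comp, ← (Equiv.curry _ _ _).symm.sum_comp]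
    refine Finset.sum_congr rfl fun g _ => ?_
    rw [Finset.prod_mul_distrib]
    congr 1
    · refine Finset.prod_congr rfl fun i _ => ?_
      rw [← pfE_zero, ← pfE_one]
      simp
    · rw [← (pfE h).prod_comp, Fintype.prod_prod_type]
      simp
  unfold bpf
  simp only [key, Finset.mul_sum]
  rw [Finset.sum_comm]
  have e2 : ∀ f : Fin n → Fin n, (∑ π : Equiv.Perm (Fin n), ((Equiv.Perm.sign π : ℤ) : R) *
      ((∏ i : Fin (n/2), A (f (pfLo h i)) (f (pfHi h i))) * ∏ j, P (π j) (f j))) =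
      (∏ i : Fin (n/2), A (f (pfLo h i)) (f (pfHi h i))) * (P.submatrix id f).det := by
    intro f
    rw [Matrix.det_apply', Finset.mul_sum]
    refine Finset.sum_congr rfl fun π _ => ?_
    simp only [Matrix.submatrix_apply, id]
    ring
  simp only [e2]
  rw [← Finset.sum_subset (Finset.subset_univ
    (Finset.univ.image (fun σ : Equiv.Perm (Fin n) => (σ : Fin n → Fin n)))),
    Finset.sum_image]
  · refine Finset.sum_congr rfl fun σ _ => ?_
    rw [Matrix.det_permute']
    ring
  · intro a _ b _ hab
    exact DFunLike.coe_injective hab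
  · intro f _ hf
    have : ¬ Function.Injective f := by
      intro hinj
      apply hf
      rw [Finset.mem_image]
      exact ⟨Equiv.ofBijective f (Finite.injective_iff_bijective.1 hinj), by simp, rfl⟩
    rw [Function.Injective] at this
    push Not at this
    obtain ⟨a, b, hab, hne⟩ := this
    rw [Matrix.det_zero_of_column_eq hne, mul_zero]
    intro k; simp [hab]

lemma pf_conj [IsDomain R] [CharZero R] {n : ℕ} (A P : Matrix (Fin n) (Fin n) R)
    (hA : ∀ i j, A j i = - A i j) :
    pf (P * A * Pᵀ) = P.det * pf A := by
  by_cases h : n % 2 = 0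
  · have hB : ∀ i j, (P * A * Pᵀ) j i = - (P * A * Pᵀ) i j := by
      have hA' : Aᵀ = -A := by ext i j; simp [hA i j]
      intro i j
      have : (P * A * Pᵀ)ᵀ = -(P * A * Pᵀ) := by
        rw [Matrix.transpose_mul, Matrix.transpose_mul, hA', Matrix.transpose_transpose]
        simp [Matrix.mul_assoc]
      exact congrFun (congrFun this i) j
    have h1 := bpf_conj h A P
    rw [bpf_eq h _ hB, bpf_eq h _ hA] at h1
    have hc : (Fintype.card (Equiv.Perm (Fin (n/2)) × (Fin (n/2) → Equiv.Perm (Fin 2))) : R) ≠ 0 := by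
      exact_mod_cast Fintype.card_ne_zero
    apply mul_left_cancel₀ hc
    rw [h1]; ring
  · simp [pf, h]

lemma pf_upper {n : ℕ} (A B : Matrix (Fin n) (Fin n) R) (hAB : ∀ i j, i < j → A i j = B i j) :
    pf A = pf B := by
  unfold pf
  split_ifs with h
  · refine Finset.sum_congr rfl fun π _ => ?_
    split_ifs with hc
    · congr 1
      exact Finset.prod_congr rfl fun i _ => hAB _ _ (hc.1 i)
    · rfl
  · rfl

end PfTheory
section PfConst

lemma pf_conj_equiv [IsDomain R] [CharZero R] {n : ℕ} {ι : Type*} [Fintype ι] [DecidableEq ι]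
    (e : Fin n ≃ ι) (A P : Matrix ι ι R) (hA : ∀ i j, A j i = - A i j) :
    pf ((P * A * Pᵀ).submatrix e e) = P.det * pf (A.submatrix e e) := by
  have h1 : (P * A * Pᵀ).submatrix e e =
      (P.submatrix e e) * (A.submatrix e e) * (P.submatrix e e)ᵀ := by
    rw [Matrix.transpose_submatrix, Matrix.submatrix_mul_equiv, Matrix.submatrix_mul_equiv]
  rw [h1, pf_conj _ _ (fun i j => by simp [hA (e i) (e j)]), Matrix.det_submatrix_equiv_self]

lemma pf_perm [IsDomain R] [CharZero R] {n : ℕ} (A : Matrix (Fin n) (Fin n) R)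
    (hA : ∀ i j, A j i = - A i j) (σ : Equiv.Perm (Fin n)) :
    pf (A.submatrix σ σ) = ((Equiv.Perm.sign σ : ℤ) : R) * pf A := by
  have h := pf_conj A ((1 : Matrix (Fin n) (Fin n) R).submatrix σ id) hA
  rw [Matrix.det_permute, Matrix.det_one, mul_one] at h
  rw [← h]
  congr 1
  ext i j
  simp [Matrix.mul_apply, Matrix.one_apply]

def jstd (R : Type*) [CommRing R] (n : ℕ) : Matrix (Fin n) (Fin n) R := fun x y =>
  if x.val % 2 = 0 ∧ y.val = x.val + 1 then 1
  else if y.val % 2 = 0 ∧ x.val = y.val + 1 then -1 else 0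

lemma jstd_skew (n : ℕ) (i j : Fin n) : jstd R n j i = - jstd R n i j := by
  unfold jstd
  split_ifs <;> first | (exfalso; omega) | simp

lemma strictMono_fin_id {k : ℕ} (f : Fin k → Fin k) (hf : StrictMono f) : f = id := by
  have := Subsingleton.elim (hf.orderIsoOfSurjective f
    (Finite.surjective_of_injective hf.injective)) (OrderIso.refl _)
  funext i
  exact congrArg (fun g : Fin k ≃o Fin k => g i) this

lemma pf_jstd {n : ℕ} (h : n % 2 = 0) : pf (jstd R n) = 1 := by
  rw [pf, dif_pos h, Finset.sum_eq_single 1]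
  · rw [if_pos]
    · simp [jstd, pfLo, pfHi]
    · refine ⟨fun i => ?_, fun i j hij => ?_⟩
      · simp [pfLo, pfHi]
      · simpa [pfLo] using hij
  · intro π _ hπ
    split_ifs with hs
    · by_cases hz : ∃ i, jstd R n (π (pfLo h i)) (π (pfHi h i)) = 0
      · obtain ⟨i, hi⟩ := hz
        rw [Finset.prod_eq_zero (Finset.mem_univ i) hi, mul_zero]
      · exfalso
        push Not at hz
        have h1 : ∀ i, (π (pfLo h i)).val % 2 = 0 ∧ (π (pfHi h i)).val = (π (pfLo h i)).val + 1 := by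
          intro i
          have h2 := hz i
          have h3 := hs.1 i
          rw [Fin.lt_def] at h3
          unfold jstd at h2
          split_ifs at h2 with h4 h5
          · exact h4
          · omega
          · exact absurd rfl h2
        let f : Fin (n/2) → Fin (n/2) := fun i => ⟨(π (pfLo h i)).val / 2, by
          have := (π (pfLo h i)).isLt; omega⟩
        have hf : f = id := by
          apply strictMono_fin_id
          intro i j hij
          have h3 := hs.2 i j hij
          rw [Fin.lt_def] at h3 ⊢
          have := h1 i
          have := h1 j
          simp only [f]
          omega
        have hlo : ∀ i, π (pfLo h i) = pfLo h i := by
          intro i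
          have h3 := congrArg Fin.val (congrFun hf i)
          have := h1 i
          ext
          simp only [f, pfLo, id] at h3 this ⊢
          omega
        apply hπ
        ext x
        obtain ⟨⟨i, a⟩, rfl⟩ := (pfE h).surjective x
        fin_cases a
        · simp [pfE_zero, hlo]
        · have h2 := h1 i
          rw [hlo] at h2
          simp only [Fin.mk_one, pfE_one, Equiv.Perm.one_apply]
          rw [h2.2]; simp [pfLo, pfHi]
    · rfl
  · simp

def shufFun (t m : ℕ) (x : Fin (t + m + m)) : Fin (t + m + m) :=
  if h : x.val < t then x else if h2 : x.val < t + m then ⟨t + 2 * (x.val - t), by omega⟩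
  else ⟨t + 2 * (x.val - t - m) + 1, by omega⟩

lemma shufFun_inj (t m : ℕ) : Function.Injective (shufFun t m) := by
  intro x y hxy
  unfold shufFun at hxy
  rw [Fin.ext_iff] at hxy ⊢
  split_ifs at hxy <;> (try simp only [] at hxy) <;> omega

noncomputable def shuf (t m : ℕ) : Equiv.Perm (Fin (t + m + m)) :=
  Equiv.ofBijective (shufFun t m) (Finite.injective_iff_bijective.1 (shufFun_inj t m))

def csgn (m : ℕ) : ℤ := ∏ i : Fin m, (-1) ^ i.val

lemma shuf_val (t m : ℕ) (x : Fin (t + m + m)) : (shuf t m x).val =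
    if x.val < t then x.val else if x.val < t + m then t + 2 * (x.val - t)
      else t + 2 * (x.val - t - m) + 1 := by
  change (shufFun t m x).val = _
  unfold shufFun
  split_ifs <;> rfl

lemma sign_as_prod {n : ℕ} (σ : Equiv.Perm (Fin n)) : ((Equiv.Perm.sign σ : ℤˣ) : ℤ) =
    ∏ i, ∏ j, if i.val < j.val ∧ (σ j).val < (σ i).val then -1 else 1 := by
  rw [σ.sign_eq_prod_prod_Ioi]
  push_cast
  refine Finset.prod_congr rfl fun i _ => ?_
  rw [← Finset.prod_subset (Finset.subset_univ (Finset.Ioi i))]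
  · refine Finset.prod_congr rfl fun j hj => ?_
    rw [Finset.mem_Ioi, Fin.lt_def] at hj
    have hne : (σ i).val ≠ (σ j).val := fun hh => by
      have := σ.injective (Fin.ext hh); subst this; omega
    simp only [Fin.lt_def]
    split_ifs <;> first | rfl | (exfalso; omega)
  · intro j _ hj
    rw [Finset.mem_Ioi, Fin.lt_def] at hj
    rw [if_neg (by tauto)]

lemma prod_lt_aux (m : ℕ) (i : Fin m) :
    (∏ j : Fin m, if j.val < i.val then (-1 : ℤ) else 1) = (-1) ^ i.val := by
  rw [Finset.prod_ite]
  simp only [Finset.prod_const, Finset.prod_const_one, mul_one]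
  congr 1
  have : (Finset.univ.filter fun j : Fin m => j.val < i.val) = Finset.Iio i := by
    ext j; simp
  rw [this]; simp

lemma sign_shuf (t m : ℕ) : ((Equiv.Perm.sign (shuf t m) : ℤˣ) : ℤ) = csgn m := by
  rw [sign_as_prod, Fin.prod_univ_add, Fin.prod_univ_add]
  simp only [Fin.prod_univ_add, shuf_val, Fin.val_castAdd, Fin.val_natAdd]
  rw [Finset.prod_eq_one, one_mul, mul_comm, Finset.prod_eq_one, one_mul, csgn]
  · refine Finset.prod_congr rfl fun i _ => ?_
    rw [Finset.prod_eq_one, one_mul, Finset.prod_eq_one, one_mul, ← prod_lt_aux]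
    · refine Finset.prod_congr rfl fun j _ => ?_
      have := i.isLt
      have := j.isLt
      split_ifs <;> first | rfl | (exfalso; omega)
    · intro j _
      have := i.isLt
      have := j.isLt
      split_ifs <;> first | rfl | (exfalso; omega)
    · intro j _
      have := i.isLt
      have := j.isLt
      split_ifs <;> first | rfl | (exfalso; omega)
  · intro i _
    have := i.isLt
    rw [Finset.prod_eq_one, one_mul, Finset.prod_eq_one, one_mul, Finset.prod_eq_one]
    all_goals
      intro j _
      have := j.isLt
      split_ifs <;> first | rfl | (exfalso; omega)
  · intro i _
    have := i.isLt
    rw [Finset.prod_eq_one, one_mul, Finset.prod_eq_one, one_mul, Finset.prod_eq_one]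
    all_goals
      intro j _
      have := j.isLt
      split_ifs <;> first | rfl | (exfalso; omega)

lemma pf_const [IsDomain R] [CharZero R] {n t m : ℕ} (hn : n = t + m + m) (ht : t % 2 = 0)
    (A : Matrix (Fin n) (Fin n) R)
    (hA : ∀ i j : Fin n, i.val < j.val → A i j =
      if (i.val < t ∧ i.val % 2 = 0 ∧ j.val = i.val + 1) ∨
        (t ≤ i.val ∧ i.val < t + m ∧ j.val = i.val + m) then 1 else 0) :
    pf A = (csgn m : R) := by
  subst hn
  rw [pf_upper A ((jstd R (t+m+m)).submatrix (shuf t m) (shuf t m)),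
    pf_perm _ (jstd_skew _), sign_shuf, pf_jstd (by omega), mul_one]
  intro i j hij
  rw [hA i j hij]
  rw [Fin.lt_def] at hij
  have := i.isLt
  have := j.isLt
  simp only [Matrix.submatrix_apply, jstd, shuf_val]
  split_ifs <;> first | rfl | (exfalso; omega)

lemma csgn_sq (m : ℕ) : csgn m * csgn m = 1 := by
  unfold csgn
  rw [← Finset.prod_mul_distrib]
  refine Finset.prod_eq_one fun i _ => ?_
  rw [← mul_pow]; simp

lemma sign_rev (m : ℕ) : ((Equiv.Perm.sign (Fin.revPerm : Equiv.Perm (Fin m)) : ℤˣ) : ℤ) = csgn m := by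
  rw [sign_as_prod, csgn, Finset.prod_comm]
  refine Finset.prod_congr rfl fun i _ => ?_
  rw [← prod_lt_aux]
  refine Finset.prod_congr rfl fun j _ => ?_
  simp only [Fin.revPerm_apply, Fin.val_rev]
  have := i.isLt
  have := j.isLt
  split_ifs <;> first | rfl | (exfalso; omega)

end PfConst
section PfBlocks

variable [IsDomain R] [CharZero R]

def strictUpper {m : ℕ} (S : Matrix (Fin m) (Fin m) R) : Matrix (Fin m) (Fin m) R :=
  fun i j => if i < j then S i j else 0

lemma pf_fromBlocks_upper {l s : ℕ} (S S' : Matrix (Fin l) (Fin l) R) (T : Matrix (Fin l) (Fin s) R)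
    (C C' : Matrix (Fin s) (Fin l) R) (h : ∀ i j, i < j → S i j = S' i j) :
    pf ((Matrix.fromBlocks S T C 0).submatrix finSumFinEquiv.symm finSumFinEquiv.symm) =
    pf ((Matrix.fromBlocks S' T C' 0).submatrix finSumFinEquiv.symm finSumFinEquiv.symm) := by
  apply pf_upper
  intro i j hij
  obtain ⟨x, rfl⟩ := finSumFinEquiv.surjective i
  obtain ⟨y, rfl⟩ := finSumFinEquiv.surjective j
  rcases x with x | x <;> rcases y with y | y <;> simp at hij ⊢
  · exact h x y hij
  · rw [Fin.lt_def] at hij; simp at hij; omega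

/-- `Pf [[S,T],[-Tᵀ,0]] = c det T` for square `T`. -/
lemma pf_square {m : ℕ} (S T : Matrix (Fin m) (Fin m) R) (C : Matrix (Fin m) (Fin m) R) :
    pf ((Matrix.fromBlocks S T C 0).submatrix finSumFinEquiv.symm finSumFinEquiv.symm) =
      (csgn m : R) * T.det := by
  set L := strictUpper S
  rw [pf_fromBlocks_upper S (L - Lᵀ) T C (-Tᵀ)]
  · have h1 : Matrix.fromBlocks (L - Lᵀ) T (-Tᵀ) 0 =
      (Matrix.fromBlocks 1 Lᵀ 0 Tᵀ) * (Matrix.fromBlocks 0 1 (-1) 0) *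
        (Matrix.fromBlocks 1 Lᵀ 0 Tᵀ)ᵀ := by
      rw [Matrix.fromBlocks_transpose, Matrix.fromBlocks_multiply, Matrix.fromBlocks_multiply]
      simp [neg_add_eq_sub]
    rw [h1, pf_conj_equiv, Matrix.det_fromBlocks_zero₂₁, Matrix.det_one, one_mul,
      Matrix.det_transpose, mul_comm]
    · congr 1
      apply pf_const (t := 0) (m := m) (by omega) rfl
      intro i j hij
      obtain ⟨x, rfl⟩ := finSumFinEquiv.surjective i
      obtain ⟨y, rfl⟩ := finSumFinEquiv.surjective j
      simp only [Matrix.submatrix_apply, Equiv.symm_apply_apply]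
      rcases x with x | x <;> rcases y with y | y <;>
        simp [Matrix.one_apply, Fin.ext_iff] at hij ⊢ <;> grind
    · rintro (i | i) (j | j) <;> simp [Matrix.one_apply, eq_comm]
  · intro i j hij
    simp [L, strictUpper, hij, hij.le.not_gt]

def threeFun (m : ℕ) : Fin 2 ⊕ (Fin m ⊕ Fin m) → Fin (m + 2) ⊕ Fin m
  | .inl a => .inl ⟨a.val, by omega⟩
  | .inr (.inl k) => .inl k.succ.succ
  | .inr (.inr k) => .inr k

lemma threeFun_bij (m : ℕ) : Function.Bijective (threeFun m) := by
  rw [Fintype.bijective_iff_injective_and_card]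
  refine ⟨?_, by simp; omega⟩
  rintro (a | a | a) (b | b | b) h <;> simp [threeFun, Fin.ext_iff] at h ⊢ <;> omega

noncomputable def threeE (m : ℕ) : Fin (m + 2 + m) ≃ Fin 2 ⊕ (Fin m ⊕ Fin m) :=
  finSumFinEquiv.symm.trans (Equiv.ofBijective _ (threeFun_bij m)).symm

lemma threeE_symm (m : ℕ) (x) : (threeE m).symm x = finSumFinEquiv (threeFun m x) := rfl

def jtwo (R : Type*) [CommRing R] : Matrix (Fin 2) (Fin 2) R := !![0, 1; -1, 0]

lemma pf_three {m : ℕ} (S : Matrix (Fin (m+2)) (Fin (m+2)) R) (T : Matrix (Fin (m+2)) (Fin m) R)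
    (C : Matrix (Fin m) (Fin (m+2)) R) (T0 S0 : Matrix (Fin m) (Fin m) R)
    (hT0 : ∀ i j, T i.succ.succ j = T0 i j) (hS0 : ∀ i j, S i.succ.succ j.succ.succ = S0 i j)
    (p0 p1 q0 q1 : Fin m → R)
    (hp0 : T 0 = p0 ᵥ* T0) (hp1 : T 1 = p1 ᵥ* T0)
    (hq0 : ∀ k : Fin m, S 0 k.succ.succ = (p0 ᵥ* strictUpper S0) k - q0 k)
    (hq1 : ∀ k : Fin m, S 1 k.succ.succ = (p1 ᵥ* strictUpper S0) k - q1 k) :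
    pf ((Matrix.fromBlocks S T C 0).submatrix finSumFinEquiv.symm finSumFinEquiv.symm) =
      (csgn m : R) * T0.det * (S 0 1 - p0 ⬝ᵥ q1 + q0 ⬝ᵥ p1) := by
  set a := S 0 1 - p0 ⬝ᵥ q1 + q0 ⬝ᵥ p1 with ha
  set L := strictUpper S0 with hL
  let p : Matrix (Fin 2) (Fin m) R := ![p0, p1]
  let q : Matrix (Fin 2) (Fin m) R := ![q0, q1]
  let K : Matrix (Fin 2 ⊕ (Fin m ⊕ Fin m)) (Fin 2 ⊕ (Fin m ⊕ Fin m)) R :=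
    Matrix.fromBlocks (jtwo R) 0 0 (Matrix.fromBlocks 0 1 (-1) 0)
  let d : Matrix (Fin 2) (Fin 2) R := !![a, 0; 0, 1]
  let P : Matrix (Fin 2 ⊕ (Fin m ⊕ Fin m)) (Fin 2 ⊕ (Fin m ⊕ Fin m)) R :=
    Matrix.fromBlocks d (Matrix.fromCols p q) 0 (Matrix.fromBlocks 1 Lᵀ 0 T0ᵀ)
  have hdet : P.det = a * T0.det := by
    simp only [P, d]
    rw [Matrix.det_fromBlocks_zero₂₁, Matrix.det_fromBlocks_zero₂₁]
    simp [Matrix.det_fin_two]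
  have hK : ∀ i j, K j i = - K i j := by
    rintro (i | i | i) (j | j | j) <;> simp [K, Matrix.one_apply, eq_comm]
    fin_cases i <;> fin_cases j <;> simp [jtwo]
  have hKpf : pf (K.submatrix (threeE m) (threeE m)) = (csgn m : R) := by
    apply pf_const (t := 2) (m := m) (by omega) rfl
    intro i j hij
    obtain ⟨x, rfl⟩ := (threeE m).symm.surjective i
    obtain ⟨y, rfl⟩ := (threeE m).symm.surjective j
    simp only [Matrix.submatrix_apply, Equiv.apply_symm_apply]
    rw [threeE_symm, threeE_symm] at hij ⊢
    rcases x with x | x | x <;> rcases y with y | y | y <;>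
      simp [K, threeFun, Matrix.one_apply, Fin.ext_iff] at hij ⊢
    · fin_cases x <;> fin_cases y <;> simp [jtwo] at hij ⊢
    all_goals grind
  have hB : P * K * Pᵀ = Matrix.fromBlocks (d * jtwo R * dᵀ - q * pᵀ + p * qᵀ)
      (Matrix.fromCols (p * L - q) (p * T0))
      (Matrix.fromRows (Lᵀ * -pᵀ + qᵀ) (-(T0ᵀ * pᵀ)))
      (Matrix.fromBlocks (L - Lᵀ) T0 (-T0ᵀ) 0) := by
    simp only [P, K]
    rw [Matrix.fromBlocks_transpose, Matrix.fromBlocks_multiply, Matrix.fromBlocks_multiply]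
    simp only [Matrix.fromBlocks_transpose, Matrix.fromBlocks_multiply, 
      Matrix.transpose_fromCols, Matrix.fromCols_mul_fromBlocks, Matrix.fromCols_mul_fromRows,
      Matrix.fromBlocks_mul_fromRows]
    congr 1
    · simp [Matrix.fromCols_mul_fromRows]; abel
    · simp [Matrix.fromCols_mul_fromBlocks, neg_add_eq_sub]
    · simp [Matrix.fromBlocks_mul_fromRows]
    · simp [Matrix.fromBlocks_multiply, neg_add_eq_sub]
  have hmain : pf ((Matrix.fromBlocks S T C 0).submatrix finSumFinEquiv.symm finSumFinEquiv.symm) =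
      pf ((P * K * Pᵀ).submatrix (threeE m) (threeE m)) := by
    apply pf_upper
    intro i j hij
    obtain ⟨x, rfl⟩ := (threeE m).symm.surjective i
    obtain ⟨y, rfl⟩ := (threeE m).symm.surjective j
    simp only [Matrix.submatrix_apply, Equiv.apply_symm_apply]
    rw [threeE_symm, threeE_symm] at hij ⊢
    rw [hB]
    simp only [Equiv.symm_apply_apply]
    rcases x with x | x | x <;> rcases y with y | y | y <;>
      simp only [threeFun, Matrix.fromBlocks_apply₁₁, Matrix.fromBlocks_apply₁₂,
        Matrix.fromBlocks_apply₂₁, Matrix.fromBlocks_apply₂₂, Matrix.fromCols_apply_inl,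
        Matrix.fromCols_apply_inr]
    · have e1 : (q * pᵀ) 0 1 = q0 ⬝ᵥ p1 := rfl
      have e2 : (p * qᵀ) 0 1 = p0 ⬝ᵥ q1 := rfl
      have e3 : (d * jtwo R * dᵀ) 0 1 = a := by simp [d, jtwo, Matrix.mul_apply, Fin.sum_univ_two]
      fin_cases x <;> fin_cases y
      · exact absurd hij (lt_irrefl _)
      · change S 0 1 = (d * jtwo R * dᵀ) 0 1 - (q * pᵀ) 0 1 + (p * qᵀ) 0 1
        rw [e1, e2, e3, ha]; ring
      · rw [Fin.lt_def] at hij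
        simp [threeFun] at hij
      · exact absurd hij (lt_irrefl _)
    · fin_cases x
      · exact hq0 y
      · exact hq1 y
    · fin_cases x
      · exact congrFun hp0 y
      · exact congrFun hp1 y
    · exfalso; simp [threeFun, Fin.lt_def] at hij; omega
    · replace hij : x < y := by
        rw [Fin.lt_def] at hij ⊢
        simp [threeFun] at hij
        exact hij
      simp [hS0, hL, strictUpper, hij, hij.le.not_gt]
    · exact hT0 x y
    · exfalso
      rw [Fin.lt_def] at hij
      simp [threeFun] at hij; omega
    · exfalso
      rw [Fin.lt_def] at hij
      simp [threeFun] at hij; omega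
  rw [hmain, pf_conj_equiv _ _ _ hK, hKpf, hdet]
  ring

end PfBlocks
section QParts

lemma pf_main_abs [IsDomain R] [CharZero R] {l s : ℕ} (S S' : Matrix (Fin l) (Fin l) R)
    (T T' : Matrix (Fin l) (Fin s) R) (C C' : Matrix (Fin s) (Fin l) R)
    (T0 : Matrix (Fin s) (Fin s) R) (M : Matrix (Fin l) (Fin s) R)
    (hdet : T0.det = (csgn s : R))
    (hT : ∀ i j, T' i j = (csgn s : R) * ((-1) ^ j.val * ∑ k, T i k * T0.adjugate k j))
    (hS : ∀ i j, i < j → S' i j = S i j - M i ⬝ᵥ T j + T i ⬝ᵥ M j) :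
    pf ((Matrix.fromBlocks S T C 0).submatrix finSumFinEquiv.symm finSumFinEquiv.symm) =
    pf ((Matrix.fromBlocks S' T' C' 0).submatrix finSumFinEquiv.symm finSumFinEquiv.symm) := by
  set L := strictUpper S with hL
  have hc : (csgn s : R) * (csgn s : R) = 1 := by
    rw [← Int.cast_mul, csgn_sq]; simp
  let D : Matrix (Fin s) (Fin s) R :=
    (T0.adjugate * Matrix.diagonal (fun j : Fin s => (csgn s : R) * (-1) ^ j.val))ᵀ
  have hD : D.det = 1 := by
    simp only [D]
    rw [Matrix.det_transpose, Matrix.det_mul, Matrix.det_adjugate, Matrix.det_diagonal, hdet,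
      Finset.prod_mul_distrib]
    have : (∏ i : Fin s, ((-1) ^ i.val : R)) = (csgn s : R) := by
      simp [csgn]
    rw [this]
    simp only [Finset.prod_const, Finset.card_univ, Fintype.card_fin]
    rcases s with _ | n
    · simp [csgn]
    · have : (csgn (n+1) : R) ^ (n + 1 - 1) * ((csgn (n+1) : R) ^ (n + 1) * (csgn (n+1) : R)) =
        ((csgn (n+1) : R) * (csgn (n+1) : R)) ^ (n + 1) := by
        rw [Nat.add_sub_cancel]; ring
      rw [this, hc, one_pow]
  have hT' : T' = T * Dᵀ := by
    ext i j
    rw [hT]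
    simp only [D, Matrix.transpose_transpose, ← Matrix.mul_assoc, Matrix.mul_diagonal]
    rw [Matrix.mul_apply]; ring
  rw [pf_fromBlocks_upper S (L - Lᵀ) T C (-Tᵀ) (by
      intro i j hij; simp [L, strictUpper, hij, hij.le.not_gt]),
    pf_fromBlocks_upper S' (L - Lᵀ - M * Tᵀ + T * Mᵀ) T' C' (-T'ᵀ)]
  · have h1 : Matrix.fromBlocks (L - Lᵀ - M * Tᵀ + T * Mᵀ) T' (-T'ᵀ) 0 =
      (Matrix.fromBlocks 1 M 0 D) * (Matrix.fromBlocks (L - Lᵀ) T (-Tᵀ) 0) *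
        (Matrix.fromBlocks 1 M 0 D)ᵀ := by
      rw [Matrix.fromBlocks_transpose, Matrix.fromBlocks_multiply, Matrix.fromBlocks_multiply, hT']
      simp [sub_eq_add_neg]
    rw [h1, pf_conj_equiv, Matrix.det_fromBlocks_zero₂₁, hD, Matrix.det_one, one_mul, one_mul]
    rintro (i | i) (j | j) <;> simp
  · intro i j hij
    rw [hS i j hij]
    have e1 : (M * Tᵀ) i j = M i ⬝ᵥ T j := rfl
    have e2 : (T * Mᵀ) i j = T i ⬝ᵥ M j := rfl
    rw [Matrix.add_apply, Matrix.sub_apply, e1, e2]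
    simp [L, strictUpper, hij, hij.le.not_gt]

lemma det_cons_adj {n : ℕ} (T0 : Matrix (Fin (n+1)) (Fin (n+1)) R) (t : Fin (n+1) → R)
    (j : Fin (n+1)) (B : Matrix (Fin (n+1)) (Fin (n+1)) R) (h0 : ∀ k, B 0 k = t k)
    (h1 : ∀ i k, B i.succ k = T0 (j.succAbove i) k) :
    B.det = (-1) ^ j.val * ∑ k, t k * T0.adjugate k j := by
  rw [Matrix.det_succ_row_zero, Finset.mul_sum]
  refine Finset.sum_congr rfl fun k _ => ?_
  rw [Matrix.adjugate_fin_succ_eq_det_submatrix, h0]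
  have : B.submatrix Fin.succ k.succAbove = T0.submatrix j.succAbove k.succAbove := by
    ext a b; simp [h1]
  rw [this, pow_add]
  have e : ((-1 : R)) ^ j.val * (-1) ^ j.val = 1 := by rw [← mul_pow]; simp
  linear_combination (-(-1) ^ k.val * t k * (T0.submatrix j.succAbove k.succAbove).det) * e

noncomputable def QT (N : ℕ) {l s : ℕ} (α : Fin l → ℕ) (ν : Fin s → ℕ) :
    Matrix (Fin l) (Fin s) (MvPolynomial (Fin N) ℤ) :=
  Matrix.of fun (i : Fin l) (j : Fin s) => Qone N ((α i : ℤ) - (ν (Fin.rev j) : ℤ))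

lemma det_QT (N : ℕ) {s : ℕ} (ν : Fin s → ℕ) (hν : StrictAnti ν) :
    (QT N ν ν).det = (csgn s : MvPolynomial (Fin N) ℤ) := by
  have h1 : ((QT N ν ν).submatrix id (Fin.revPerm : Equiv.Perm (Fin s))).det = 1 := by
    rw [Matrix.det_of_upperTriangular]
    · refine Finset.prod_eq_one fun i _ => ?_
      simp [QT, Qone, qQ]
    · intro i j hij
      have : ν i < ν j := hν hij
      simp only [QT, Matrix.submatrix_apply, id, Fin.revPerm_apply, Matrix.of_apply, Fin.rev_rev,
        Qone]
      rw [if_neg (by omega)]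
  rw [Matrix.det_permute', sign_rev] at h1
  have hc : (csgn s : MvPolynomial (Fin N) ℤ) * (csgn s : MvPolynomial (Fin N) ℤ) = 1 := by
    rw [← Int.cast_mul, csgn_sq]; simp
  linear_combination (csgn s : MvPolynomial (Fin N) ℤ) * h1 - (QT N ν ν).det * hc

lemma QJP_col (N : ℕ) {s : ℕ} (a : ℕ) (μs ν : Fin s → ℕ) (j : Fin s) (h : s = s - 1 + 1) :
    QJP N ((Fin.cons a (removeAt μs j) : Fin (s - 1 + 1) → ℕ) ∘ Fin.cast h) ν =
      (csgn s : MvPolynomial (Fin N) ℤ) * ((-1) ^ j.val *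
        ∑ k, Qone N ((a : ℤ) - (ν (Fin.rev k) : ℤ)) * (QT N μs ν).adjugate k j) := by
  rcases s with _ | n
  · exact j.elim0
  · unfold QJP
    rw [pf_square]
    congr 1
    apply det_cons_adj
    · intro k; rfl
    · intro i k; rfl

lemma QExt_pair (N : ℕ) {m : ℕ} (μ : Fin m → ℕ) (hμ : StrictAnti μ) :
    ∃ M : ℕ → Fin m → MvPolynomial (Fin N) ℤ, ∀ a b : ℕ,
      QExt N (Fin.cons a (Fin.cons b μ) : Fin (m + 2) → ℕ) μ = Qpair N a b
        - M a ⬝ᵥ (fun k => Qone N ((b : ℤ) - (μ (Fin.rev k) : ℤ)))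
        + (fun k => Qone N ((a : ℤ) - (μ (Fin.rev k) : ℤ))) ⬝ᵥ M b := by
  have hc : (csgn m : MvPolynomial (Fin N) ℤ) * (csgn m : MvPolynomial (Fin N) ℤ) = 1 := by
    rw [← Int.cast_mul, csgn_sq]; simp
  let c : MvPolynomial (Fin N) ℤ := (csgn m : MvPolynomial (Fin N) ℤ)
  let T0 := QT N μ μ
  let v : ℕ → Fin m → MvPolynomial (Fin N) ℤ :=
    fun a k => Qone N ((a : ℤ) - (μ (Fin.rev k) : ℤ))
  let S0 : Matrix (Fin m) (Fin m) (MvPolynomial (Fin N) ℤ) :=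
    Matrix.of fun i j => Qpair N (μ i) (μ j)
  let I : Matrix (Fin m) (Fin m) (MvPolynomial (Fin N) ℤ) := c • T0.adjugate
  let p : ℕ → Fin m → MvPolynomial (Fin N) ℤ := fun a => v a ᵥ* I
  let q : ℕ → Fin m → MvPolynomial (Fin N) ℤ := fun a k =>
    (p a ᵥ* strictUpper S0) k - Qpair N a (μ k)
  have hd : T0.det = c := det_QT N μ hμ
  have hI : I * T0 = 1 := by
    simp only [I]
    rw [Matrix.smul_mul, Matrix.adjugate_mul, hd, smul_smul, hc, one_smul]
  have hp : ∀ a, v a = p a ᵥ* T0 := by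
    intro a
    simp only [p]
    rw [Matrix.vecMul_vecMul, hI, Matrix.vecMul_one]
  refine ⟨fun a => - (I *ᵥ q a), fun a b => ?_⟩
  rw [QExt, if_pos (by omega), QJP]
  rw [pf_three _ _ _ T0 S0 (fun i j => rfl) (fun i j => rfl) (p a) (p b) (q a) (q b)
    (hp a) (hp b)]
  · rw [hd, show (csgn m : MvPolynomial (Fin N) ℤ) * c = 1 from hc, one_mul]
    change Qpair N a b - p a ⬝ᵥ q b + q a ⬝ᵥ p b = Qpair N a b - (-(I *ᵥ q a)) ⬝ᵥ v b
      + v a ⬝ᵥ (- (I *ᵥ q b))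
    rw [neg_dotProduct, dotProduct_neg, Matrix.dotProduct_mulVec, dotProduct_comm (I *ᵥ q a),
      Matrix.dotProduct_mulVec, dotProduct_comm (q a)]
    ring
  · intro k
    simp [q]
  · intro k
    simp only [q]
    rw [sub_sub_cancel]; rfl

end QParts

/-- The skew generalization of the Schur Pfaffian identity: for strict partitions `λ` and
`μ`, `Q_{λ/μ}` equals the Pfaffian of the matrix described in `skewQRHS`, with `s = m` if
`l + m` is even and `s = m + 1` (appending `μ_{m+1} = 0`) if `l + m` is odd. -/
theorem skew_schur_Q_pfaffian (N : ℕ) {l m : ℕ} (lam : Fin l → ℕ) (μ : Fin m → ℕ)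
    (hlam : StrictAnti lam) (hlam' : ∀ i, 0 < lam i)
    (hμ : StrictAnti μ) (hμ' : ∀ i, 0 < μ i) :
    ((l + m) % 2 = 0 → QExt N lam μ = skewQRHS N lam μ μ) ∧
    ((l + m) % 2 ≠ 0 → QExt N lam μ = skewQRHS N lam μ (Fin.snoc μ 0)) := by
  obtain ⟨M, hM⟩ := QExt_pair N μ hμ
  refine ⟨fun h => ?_, fun h => ?_⟩
  · rw [QExt, if_pos h, QJP, skewQRHS]
    apply pf_main_abs (T0 := QT N μ μ) (M := Matrix.of fun i k => M (lam i) k)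
    · exact det_QT N μ hμ
    · intro i j
      rw [Matrix.of_apply, QExt, if_pos (by omega), QJP_col]
      rfl
    · intro i j hij
      rw [Matrix.of_apply, if_pos hij, hM]
      rfl
  · have hν : StrictAnti (Fin.snoc μ 0 : Fin (m + 1) → ℕ) := by
      intro i j hij
      induction i using Fin.lastCases with
      | last => exact absurd hij (Fin.le_last j).not_gt
      | cast i =>
        induction j using Fin.lastCases with
        | last => simpa using hμ' i
        | cast j => simpa using hμ (by simpa using hij)
    rw [QExt, if_neg h, QJP, skewQRHS]
    apply pf_main_abs (T0 := QT N (Fin.snoc μ 0 : Fin (m + 1) → ℕ) (Fin.snoc μ 0 : Fin (m + 1) → ℕ))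
      (M := Matrix.of fun i => (Fin.cons 0 (M (lam i)) : Fin (m + 1) → _))
    · exact det_QT N _ hν
    · intro i j
      rw [Matrix.of_apply, QExt, if_neg (by omega), QJP_col]
      rfl
    · intro i j hij
      rw [Matrix.of_apply, if_pos hij, hM]
      simp only [dotProduct, Fin.sum_univ_succ, Matrix.of_apply, Fin.cons_zero, Fin.cons_succ,
        zero_mul, mul_zero, zero_add, Fin.rev_succ, Fin.snoc_castSucc]
end
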